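/- arXiv:2511.22358 — 3 statements merged into one kernel-verified Lean document; each statement's English description precedes it below -/
import Mathlib

section
/- Let T be an n-vertex (4,1)-tree with root v, and let v_1, …, v_t be the children of v from left to right. Then for every forest T' on n' ≤ n vertices and for all vertices x_1, x_2 of T' (not necessarily distinct), there exists a T-admissible embedding φ of T' into G²_T such that: (Φ1) L(φ(x_1)) is minimum among the levels L(φ(u)) over all vertices u of T'; and (Φ2) if t = 2 and n − 2 ≥ n' ≥ ν(v_t) ≥ 2, then L(φ(x_2)) ≤ 2. -/
/-- A DFS-ordered rooted tree on the vertices `0, 1, …, N-1`, listed in DFS preorder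
(the root is `0` and the children of each vertex are ordered by their labels).
It is encoded by its parent function: `parent j < j` for every non-root vertex `j`, and the
labelling is a DFS preorder exactly when the parent of each vertex `j ≥ 1` is `j - 1` or an
ancestor of `j - 1`. By convention `parent 0 = 0`. -/
structure DFSTree (N : ℕ) : Type where
  parent : ℕ → ℕ
  parent_zero : parent 0 = 0
  parent_lt : ∀ j, 0 < j → j < N → parent j < j
  preorder_chain : ∀ j, 0 < j → j < N → ∃ k, parent^[k] (j - 1) = parent j

namespace DFSTree

variable {N : ℕ}

/-- The level `L u` of a vertex `u`: its distance to the root `0`. -/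
noncomputable def level (T : DFSTree N) (u : ℕ) : ℕ :=
  sInf {k | T.parent^[k] u = 0}

/-- `D[u]`: the set of descendants of `u`, including `u` itself. -/
def descCl (T : DFSTree N) (u : ℕ) : Set ℕ :=
  {w | w < N ∧ ∃ k, T.parent^[k] w = u}

/-- `w ∈ D(u)`: `w` is a strict descendant of `u`. -/
def StrictDesc (T : DFSTree N) (u w : ℕ) : Prop :=
  w ∈ T.descCl u ∧ w ≠ u

/-- `w` is a left-sibling of `u`. -/
def LeftSib (T : DFSTree N) (u w : ℕ) : Prop :=
  0 < w ∧ w < u ∧ T.parent w = T.parent u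

/-- `w = l u` is the nearest left-cousin of `u`: the last vertex before `u` in the DFS order
having the same level as `u`. -/
def Nlc (T : DFSTree N) (u w : ℕ) : Prop :=
  w < u ∧ T.level w = T.level u ∧ ∀ c, w < c → c < u → T.level c ≠ T.level u

/-- `w = r u` is the nearest right-cousin of `u`: the first vertex after `u` in the DFS order
having the same level as `u`. -/
def Nrc (T : DFSTree N) (u w : ℕ) : Prop :=
  u < w ∧ w < N ∧ T.level w = T.level u ∧ ∀ c, u < c → c < w → T.level c ≠ T.level u

/-- The arc relation generating `G^h_T`: rules (G1)–(G4). -/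
def Arc (T : DFSTree N) (h : ℕ) (u w : ℕ) : Prop :=
  -- (G1) w ∈ D(u)
  T.StrictDesc u w
  -- (G2) w is a left-sibling of u, or a strict descendant of a left-sibling of u
  ∨ (∃ s, T.LeftSib u s ∧ (w = s ∨ T.StrictDesc s w))
  -- (G3) w = l(u*) (u* the parent of u), or a strict descendant of l(u*)
  ∨ (0 < u ∧ ∃ s, T.Nlc (T.parent u) s ∧ (w = s ∨ T.StrictDesc s w))
  -- (G4) with u' the h-th ancestor of u
  ∨ (w = T.parent^[h] u
      ∨ T.Nlc (T.parent^[h] u) w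
      ∨ T.Nrc (T.parent^[h] u) w
      ∨ (((∃ s, T.Nlc (T.parent^[h] u) s ∧ T.StrictDesc s w)
            ∨ T.StrictDesc (T.parent^[h] u) w
            ∨ (∃ s, T.Nrc (T.parent^[h] u) s ∧ T.StrictDesc s w))
          ∧ T.level w ≤ T.level u))

/-- The graph `G^h_T` that is `h`-generated by `T`, as a simple graph on `ℕ` all of whose
edges lie within the vertex set `{0, …, N-1}` of `T`. -/
def graph (T : DFSTree N) (h : ℕ) : SimpleGraph ℕ :=
  SimpleGraph.fromRel (fun u w => u < N ∧ w < N ∧ T.Arc h u w)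

/-- `T` is a `(K, s)`-tree: conditions (T1)–(T4), where `ν u = |D[u]|`. -/
def IsKSTree (T : DFSTree N) (K s : ℕ) : Prop :=
  ∀ u, u < N →
    -- (T1) if l(l(u)) exists then ν(l(l(u))) + ν(l(u)) ≥ ν(u)
    ((∀ a b, T.Nlc u a → T.Nlc a b →
        (T.descCl u).ncard ≤ (T.descCl b).ncard + (T.descCl a).ncard) ∧
     -- (T2) if l(u) exists then K·ν(l(u)) ≥ ν(u)
     (∀ a, T.Nlc u a → (T.descCl u).ncard ≤ K * (T.descCl a).ncard) ∧
     -- (T3) if u is not the rightmost vertex of its level then ν(u) ≥ ν(u')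
     -- for every u' with L(u') ≥ L(u) + s
     ((∃ w, u < w ∧ w < N ∧ T.level w = T.level u) →
        ∀ u', u' < N → T.level u + s ≤ T.level u' →
          (T.descCl u').ncard ≤ (T.descCl u).ncard) ∧
     -- (T4) if u has a child and l(u) exists then l(u) has a child
     ((∃ c, 0 < c ∧ c < N ∧ T.parent c = u) →
        ∀ a, T.Nlc u a → ∃ c', 0 < c' ∧ c' < N ∧ T.parent c' = a))

end DFSTree

/-- The positions in `[p, q)` whose level is at least `ℓ`. -/
def upperPart (L : ℕ → ℕ) (p q ℓ : ℕ) : Finset ℕ :=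
  (Finset.Ico p q).filter (fun i => ℓ ≤ L i)

/-- `a < b` are consecutive among the positions of level `ℓ`. -/
def ConsecAt (L : ℕ → ℕ) (a b ℓ : ℕ) : Prop :=
  a < b ∧ L a = ℓ ∧ L b = ℓ ∧ ∀ c, a < c → c < b → L c ≠ ℓ

/-- `v` is the last position below `M` of level `ℓ`. -/
def LastAt (L : ℕ → ℕ) (v M ℓ : ℕ) : Prop :=
  v < M ∧ L v = ℓ ∧ ∀ c, v < c → c < M → L c ≠ ℓ

/-- The properties of `G²_T` for a `(4,1)`-tree `T` that the embedding argument relies on, in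
terms of the level function `L` alone. -/
structure LayeredGraph (L : ℕ → ℕ) (N : ℕ) (H : SimpleGraph ℕ) : Prop where
  step : ∀ i, i + 1 < N → L (i + 1) ≤ L i + 1
  adj_desc : ∀ u w, u < w → w < N → (∀ c, u < c → c ≤ w → L u < L c) → H.Adj u w
  adj_left : ∀ u w, w < u → u < N → 1 ≤ L u → L u ≤ L w →
    (∀ c c', w < c → c ≤ u → w < c' → c' ≤ u → L c + 1 = L u → L c' + 1 = L u → c = c') →
    H.Adj u w
  adj_near : ∀ u w, u ≠ w → u < N → w < N → 2 ≤ L u → L w ≤ L u → L u ≤ L w + 1 →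
    (∀ c c', min u w < c → c ≤ max u w → min u w < c' → c' ≤ max u w →
      L c + 2 = L u → L c' + 2 = L u → c = c') →
    H.Adj u w
  sum_two : ∀ a b c M ℓ, M ≤ N → ConsecAt L a b ℓ → ConsecAt L b c ℓ → LastAt L c M ℓ →
    (upperPart L c M ℓ).card ≤ (upperPart L a b ℓ).card + (upperPart L b c ℓ).card
  four_mul : ∀ a b M ℓ, M ≤ N → ConsecAt L a b ℓ → LastAt L b M ℓ →
    (upperPart L b M ℓ).card ≤ 4 * (upperPart L a b ℓ).card
  next_level : ∀ a b u M ℓ, b < N → M ≤ N → ConsecAt L a b ℓ → LastAt L u M (ℓ + 1) →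
    (upperPart L u M (ℓ + 1)).card ≤ (upperPart L a b ℓ).card
  two_le : ∀ a b M ℓ, M ≤ N → ConsecAt L a b ℓ → LastAt L b M ℓ →
    2 ≤ (upperPart L b M ℓ).card → 2 ≤ (upperPart L a b ℓ).card

/-- There is at most one position of level `ℓ - 1` in `[p, M)`. -/
def SingleGap (L : ℕ → ℕ) (p M ℓ : ℕ) : Prop :=
  ∀ u u', p ≤ u → u < M → p ≤ u' → u' < M → L u + 1 = ℓ → L u' + 1 = ℓ → u = u'

section upperPart

variable {L : ℕ → ℕ} {p q M ℓ : ℕ}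

theorem mem_upperPart {i : ℕ} : i ∈ upperPart L p q ℓ ↔ p ≤ i ∧ i < q ∧ ℓ ≤ L i := by
  simp [upperPart, and_assoc]

theorem upperPart_union (h1 : p ≤ q) (h2 : q ≤ M) :
    upperPart L q M ℓ ∪ upperPart L p q ℓ = upperPart L p M ℓ := by
  ext i; simp only [Finset.mem_union, mem_upperPart]; omega

theorem disjoint_upperPart : Disjoint (upperPart L q M ℓ) (upperPart L p q ℓ) := by
  rw [Finset.disjoint_left]; intro i; simp only [mem_upperPart]; omega

theorem card_upperPart_add (h1 : p ≤ q) (h2 : q ≤ M) :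
    (upperPart L q M ℓ).card + (upperPart L p q ℓ).card = (upperPart L p M ℓ).card := by
  rw [← upperPart_union h1 h2, Finset.card_union_of_disjoint disjoint_upperPart]

theorem card_upperPart_anti (h : p ≤ q) :
    (upperPart L q M ℓ).card ≤ (upperPart L p M ℓ).card := by
  apply Finset.card_le_card; intro i; simp only [mem_upperPart]; omega

theorem card_upperPart_lt (h : p < q) (hp : p < M) (hl : ℓ ≤ L p) :
    (upperPart L q M ℓ).card < (upperPart L p M ℓ).card := by
  apply Finset.card_lt_card
  rw [Finset.ssubset_iff_of_subset]
  · exact ⟨p, mem_upperPart.2 ⟨le_rfl, hp, hl⟩, fun h' => by have := mem_upperPart.1 h'; omega⟩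
  · intro i; simp only [mem_upperPart]; omega

theorem le_of_card_upperPart_le {v : ℕ} (hv : v < M) (hl : ℓ ≤ L v)
    (h : (upperPart L v M ℓ).card ≤ (upperPart L q M ℓ).card) : q ≤ v := by
  by_contra hc
  have := card_upperPart_lt (L := L) (ℓ := ℓ) (p := v) (q := q) (M := M) (by omega) hv hl
  omega

theorem lt_of_card_upperPart_lt {v : ℕ}
    (h : (upperPart L q M ℓ).card < (upperPart L v M ℓ).card) : v < q := by
  by_contra hc
  have := card_upperPart_anti (L := L) (ℓ := ℓ) (p := q) (q := v) (M := M) (by omega)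
  omega

theorem exists_card_upperPart_eq (h : p ≤ M) {n : ℕ} (hn : n ≤ (upperPart L p M ℓ).card) :
    ∃ q, p ≤ q ∧ q ≤ M ∧ (upperPart L q M ℓ).card = n := by
  induction h using Nat.decreasingInduction with
  | self => exact ⟨M, le_rfl, le_rfl, by simp [upperPart] at hn ⊢; omega⟩
  | of_succ k hk ih =>
    by_cases h' : n ≤ (upperPart L (k + 1) M ℓ).card
    · obtain ⟨q, h1, h2, h3⟩ := ih h'
      exact ⟨q, by omega, h2, h3⟩
    · refine ⟨k, le_rfl, hk.le, le_antisymm ?_ hn⟩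
      have h1 := card_upperPart_add (L := L) (ℓ := ℓ) (p := k) (q := k + 1) (M := M)
        (by omega) hk
      have h2 : (upperPart L k (k + 1) ℓ).card ≤ 1 := by
        refine (Finset.card_filter_le _ _).trans ?_
        simp
      omega

theorem exists_mem_upperPart_min (h : (upperPart L p M ℓ).Nonempty) :
    ∃ v ∈ upperPart L p M ℓ, ∀ u ∈ upperPart L p M ℓ, L v ≤ L u :=
  Finset.exists_min_image _ _ h

/-- The last position of level `ℓ` in `[p, M)`. -/
theorem exists_lastAt (h : ∃ v, p ≤ v ∧ v < M ∧ L v = ℓ) : ∃ v, p ≤ v ∧ LastAt L v M ℓ := by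
  obtain ⟨w, hw1, hw2, hw3⟩ := h
  obtain ⟨v, hv, hmax⟩ := Finset.exists_max_image
    ((Finset.Ico p M).filter (fun i => L i = ℓ)) id ⟨w, by simp [*]⟩
  simp only [Finset.mem_filter, Finset.mem_Ico, id] at hv hmax
  refine ⟨v, hv.1.1, hv.1.2, hv.2, fun c h1 h2 h3 => ?_⟩
  have := hmax c ⟨⟨by omega, h2⟩, h3⟩
  omega

theorem SingleGap.mono {p' M' : ℕ} (h : SingleGap L p M ℓ) (hp : p ≤ p') (hM : M' ≤ M) :
    SingleGap L p' M' ℓ :=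
  fun u u' h1 h2 h3 h4 => h u u' (by omega) (by omega) (by omega) (by omega)

end upperPart

/-- A sequence rising by at most one per step attains all intermediate values. -/
theorem exists_level_eq_of_step {L : ℕ → ℕ} {N : ℕ}
    (hL : ∀ i, i + 1 < N → L (i + 1) ≤ L i + 1) {u w k : ℕ} (huw : u ≤ w) (hw : w < N)
    (hu : L u ≤ k) (hk : k ≤ L w) : ∃ c, u ≤ c ∧ c ≤ w ∧ L c = k := by
  induction w, huw using Nat.le_induction with
  | base => exact ⟨u, le_rfl, le_rfl, by omega⟩
  | succ w h ih =>
    by_cases h' : k ≤ L w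
    · obtain ⟨c, h1, h2, h3⟩ := ih (by omega) h'
      exact ⟨c, h1, by omega, h3⟩
    · have := hL w hw
      exact ⟨w + 1, by omega, le_rfl, by omega⟩

namespace LayeredGraph

variable {L : ℕ → ℕ} {N : ℕ} {H : SimpleGraph ℕ} {p M ℓ : ℕ}

theorem exists_level_eq (hL : LayeredGraph L N H) {u w k : ℕ} (huw : u ≤ w) (hw : w < N)
    (hu : L u ≤ k) (hk : k ≤ L w) : ∃ c, u ≤ c ∧ c ≤ w ∧ L c = k :=
  exists_level_eq_of_step hL.step huw hw hu hk

theorem adj_of_lt (hL : LayeredGraph L N H) (hM : M ≤ N) (hK : SingleGap L p M ℓ) (hl : 1 ≤ ℓ)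
    {u w : ℕ} (hu : u ∈ upperPart L p M ℓ) (hw : w ∈ upperPart L p M ℓ) (hwu : w < u)
    (hLu : L u = ℓ) : H.Adj u w := by
  rw [mem_upperPart] at hu hw
  refine hL.adj_left u w hwu (by omega) (by omega) (by omega) ?_
  intro c c' h1 h2 h3 h4 h5 h6
  exact hK c c' (by omega) (by omega) (by omega) (by omega) (by omega) (by omega)

theorem adj_of_near (hL : LayeredGraph L N H) (hM : M ≤ N) (hK : SingleGap L p M ℓ)
    (hl : 1 ≤ ℓ) {u w : ℕ} (hu : u ∈ upperPart L p M ℓ) (hw : w ∈ upperPart L p M ℓ)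
    (huw : u ≠ w) (hLu : L u ≤ ℓ + 1) (hLw : L w ≤ ℓ + 1) : H.Adj u w := by
  wlog hle : L w ≤ L u generalizing u w
  · exact (this hw hu huw.symm hLw hLu (by omega)).symm
  have hu' := mem_upperPart.1 hu
  have hw' := mem_upperPart.1 hw
  by_cases h : L u = ℓ
  · rcases lt_or_gt_of_ne huw with h1 | h1
    · exact (hL.adj_of_lt hM hK hl hw hu h1 (by omega)).symm
    · exact hL.adj_of_lt hM hK hl hu hw h1 h
  · refine hL.adj_near u w huw (by omega) (by omega) (by omega) hle (by omega) ?_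
    intro c c' h1 h2 h3 h4 h5 h6
    exact hK c c' (by omega) (by omega) (by omega) (by omega) (by omega) (by omega)

theorem lt_of_unique (hL : LayeredGraph L N H) (hM : M ≤ N) {v w : ℕ}
    (hw : w ∈ upperPart L p M ℓ)
    (huniq : ∀ c, v < c → c ≤ w → L c ≠ ℓ) {c : ℕ} (hc : v < c) (hcw : c ≤ w) : ℓ < L c := by
  by_contra h
  rw [mem_upperPart] at hw
  obtain ⟨d, h1, h2, h3⟩ := hL.exists_level_eq hcw (by omega) (by omega : L c ≤ ℓ) hw.2.2
  exact huniq d (by omega) h2 h3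

theorem adj_of_unique (hL : LayeredGraph L N H) (hM : M ≤ N) {v w : ℕ} (hv : L v = ℓ)
    (hw : w ∈ upperPart L p M ℓ) (hvw : v < w)
    (huniq : ∀ c, v < c → c ≤ w → L c ≠ ℓ) : H.Adj v w := by
  refine hL.adj_desc v w hvw (by have := mem_upperPart.1 hw; omega) fun c h1 h2 => ?_
  rw [hv]
  exact hL.lt_of_unique hM hw huniq h1 h2

end LayeredGraph

section IsEmb

variable {V : Type*} {G : SimpleGraph V} {H : SimpleGraph ℕ}

/-- `φ` embeds the subgraph of `G` induced on `S` into `H`, with image inside `X`. -/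
def IsEmb (G : SimpleGraph V) (H : SimpleGraph ℕ) (S : Finset V) (φ : V → ℕ) (X : Finset ℕ) :
    Prop :=
  Set.InjOn φ S ∧ (∀ a ∈ S, φ a ∈ X) ∧ ∀ a ∈ S, ∀ b ∈ S, G.Adj a b → H.Adj (φ a) (φ b)

theorem isEmb_singleton (x : V) (v : ℕ) : IsEmb G H {x} (fun _ => v) {v} := by
  refine ⟨by simp, by simp, ?_⟩
  intro a ha b hb hab
  simp only [Finset.mem_singleton] at ha hb
  subst ha; subst hb
  exact absurd hab (SimpleGraph.irrefl _)

theorem IsEmb.glue [DecidableEq V] {A S : Finset V} {X Y Z : Finset ℕ} {f g : V → ℕ}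
    (hf : IsEmb G H A f X) (hg : IsEmb G H (S \ A) g Y)
    (hd : Disjoint X Y) (hZ : X ∪ Y = Z)
    (hc : ∀ a ∈ A, ∀ b ∈ S, b ∉ A → G.Adj a b → H.Adj (f a) (g b)) :
    ∃ φ, IsEmb G H S φ Z ∧ (∀ a ∈ A, φ a = f a) ∧ (∀ b, b ∉ A → φ b = g b) := by
  rw [Finset.disjoint_left] at hd
  have hg' : ∀ b ∈ S, b ∉ A → g b ∈ Y := fun b h1 h2 => hg.2.1 b (by simp [h1, h2])
  refine ⟨fun a => if a ∈ A then f a else g a, ⟨?_, ?_, ?_⟩, ?_, ?_⟩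
  · intro a ha b hb hab
    by_cases h1 : a ∈ A <;> by_cases h2 : b ∈ A <;> simp only [h1, h2, if_true, if_false] at hab
    · exact hf.1 h1 h2 hab
    · exact absurd (hg' b hb h2) (hab ▸ hd (hf.2.1 a h1))
    · exact absurd (hg' a ha h1) (hab ▸ hd (hf.2.1 b h2))
    · exact hg.1 (by simpa [h1] using ha) (by simpa [h2] using hb) hab
  · intro a ha
    subst hZ
    by_cases h1 : a ∈ A <;> simp only [h1, if_true, if_false, Finset.mem_union]
    · exact Or.inl (hf.2.1 a h1)
    · exact Or.inr (hg' a ha h1)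
  · intro a ha b hb hab
    by_cases h1 : a ∈ A <;> by_cases h2 : b ∈ A <;> simp only [h1, h2, if_true, if_false]
    · exact hf.2.2 a h1 b h2 hab
    · exact hc a h1 b hb h2 hab
    · exact (hc b h2 a ha h1 hab.symm).symm
    · exact hg.2.2 a (by simp [ha, h1]) b (by simp [hb, h2]) hab
  · intro a ha; simp [ha]
  · intro a ha; simp [ha]

end IsEmb

section embedding

variable {V : Type*} {G : SimpleGraph V} {L : ℕ → ℕ} {N : ℕ}
  {H : SimpleGraph ℕ}

/-- Every induced subgraph of `G` on `n` vertices embeds onto each `upperPart L p M ℓ` of size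
`n` having a single gap, with a prescribed vertex placed on the lowest level. -/
def Fills (G : SimpleGraph V) (L : ℕ → ℕ) (N : ℕ) (H : SimpleGraph ℕ) (n : ℕ) : Prop :=
  ∀ ℓ p M, 1 ≤ ℓ → M ≤ N → SingleGap L p M ℓ → ∀ S : Finset V, S.card = n →
    (upperPart L p M ℓ).card = n → ∀ x ∈ S, ∃ φ, IsEmb G H S φ (upperPart L p M ℓ) ∧
      ∀ u ∈ upperPart L p M ℓ, L (φ x) ≤ L u

theorem Fills.exists_level_eq {n ℓ p M : ℕ} (hF : Fills G L N H n) (hl : 1 ≤ ℓ) (hM : M ≤ N)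
    (hK : SingleGap L p M ℓ) {S : Finset V} (hS : S.card = n)
    (hX : (upperPart L p M ℓ).card = n) {x : V} (hx : x ∈ S) {k u : ℕ} (hk : ℓ ≤ k)
    (hpu : p ≤ u) (huM : u < M) (hu : L u = k) :
    ∃ φ, IsEmb G H S φ (upperPart L p M ℓ) ∧ L (φ x) ≤ k := by
  obtain ⟨φ, h1, h2⟩ := hF ℓ p M hl hM hK S hS hX x hx
  exact ⟨φ, h1, hu ▸ h2 u (mem_upperPart.2 ⟨hpu, huM, by omega⟩)⟩

variable [DecidableEq V]

theorem exists_isEmb_of_unique (hL : LayeredGraph L N H) {ℓ p M v : ℕ} {S : Finset V}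
    (hF : ∀ k < S.card, Fills G L N H k) (hl : 1 ≤ ℓ) (hM : M ≤ N) (hK : SingleGap L p M ℓ)
    (hpv : p ≤ v) (hvM : v < M) (hv : L v = ℓ)
    (huniq : ∀ c, p ≤ c → c < M → L c = ℓ → c = v)
    (hS : S.card = (upperPart L p M ℓ).card) {x y : V} (hx : x ∈ S) (hy : y ∈ S) :
    ∃ φ, IsEmb G H S φ (upperPart L p M ℓ) ∧ L (φ x) = ℓ ∧
      ((∃ u, p ≤ u ∧ u < M ∧ L u = ℓ + 1) → L (φ y) ≤ ℓ + 1) := by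
  have hvX : v ∈ upperPart L p M ℓ := mem_upperPart.2 ⟨hpv, hvM, hv.ge⟩
  have hX : upperPart L p M (ℓ + 1) = (upperPart L p M ℓ).erase v := by
    ext i
    simp only [Finset.mem_erase, mem_upperPart]
    constructor
    · rintro ⟨h1, h2, h3⟩
      exact ⟨by rintro rfl; omega, h1, h2, by omega⟩
    · rintro ⟨h0, h1, h2, h3⟩
      have := mt (huniq i h1 h2) h0
      exact ⟨h1, h2, by omega⟩
  have hK' : SingleGap L p M (ℓ + 1) := by
    intro u u' h1 h2 h3 h4 h5 h6
    rw [huniq u h1 h2 (by omega), huniq u' h3 h4 (by omega)]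
  have hcard : (S.erase x).card = (upperPart L p M (ℓ + 1)).card := by
    rw [hX, Finset.card_erase_of_mem hx, Finset.card_erase_of_mem hvX, hS]
  have key : ∀ y' ∈ S.erase x, ∃ φ, IsEmb G H S φ (upperPart L p M ℓ) ∧ L (φ x) = ℓ ∧
      ∀ u ∈ upperPart L p M (ℓ + 1), L (φ y') ≤ L u := by
    intro y' hy'
    obtain ⟨g, hg, hmin⟩ := hF _ (Finset.card_erase_lt_of_mem hx) (ℓ + 1) p M (by omega) hM hK'
      (S.erase x) rfl hcard.symm y' hy'
    rw [hX] at hg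
    rw [← Finset.sdiff_singleton_eq_erase] at hg
    obtain ⟨φ, h1, h2, h3⟩ := IsEmb.glue (isEmb_singleton x v) hg (Z := upperPart L p M ℓ) (by simp)
      (by ext i; by_cases hi : i = v <;> simp [hi, hvX]) (by
        intro a ha b hb hbx _
        have hgb := hg.2.1 b (by simpa using ⟨hb, by simpa using hbx⟩)
        rw [Finset.mem_erase] at hgb
        have hgb' := mem_upperPart.1 hgb.2
        rcases lt_or_gt_of_ne hgb.1 with h | h
        · exact hL.adj_of_lt hM hK hl hvX hgb.2 h hv
        · refine hL.adj_of_unique hM hv hgb.2 h fun c h1 h2 h3 => ?_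
          have := huniq c (by omega) (by omega) h3
          omega)
    refine ⟨φ, h1, by rw [h2 x (by simp), hv], fun u hu => ?_⟩
    rw [h3 y' (by simpa using (Finset.mem_erase.1 hy').1)]
    exact hmin u hu
  by_cases hyx : y = x
  · subst hyx
    rcases (S.erase y).eq_empty_or_nonempty with he | ⟨y', hy'⟩
    · have hSy : S = {y} := by
        rw [← Finset.insert_erase hx, he]; rfl
      refine ⟨fun _ => v, ?_, hv, fun _ => by simp only [hv]; omega⟩
      have h1 := isEmb_singleton (G := G) (H := H) y v
      rw [← hSy] at h1
      exact ⟨h1.1, fun _ _ => hvX, h1.2.2⟩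
    · obtain ⟨φ, h1, h2, -⟩ := key y' hy'
      exact ⟨φ, h1, h2, fun _ => by omega⟩
  · obtain ⟨φ, h1, h2, h3⟩ := key y (Finset.mem_erase.2 ⟨hyx, hy⟩)
    refine ⟨φ, h1, h2, ?_⟩
    rintro ⟨u, h4, h5, h6⟩
    rw [← h6]
    exact h3 u (mem_upperPart.2 ⟨h4, h5, h6.ge⟩)

/-- Gluing along a hub: all edges between `A` and the rest are at `z`. -/
theorem exists_isEmb_of_hub (hL : LayeredGraph L N H) {ℓ p M v v' : ℕ} {S A : Finset V}
    (hF : ∀ k < S.card, Fills G L N H k) (hl : 1 ≤ ℓ) (hM : M ≤ N) (hK : SingleGap L p M ℓ)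
    (hpv' : p ≤ v') (hvM : v < M) (hv : L v = ℓ) (hv' : L v' = ℓ)
    (hS : S.card = (upperPart L p M ℓ).card) (hA : A ⊆ S)
    (hA1 : (upperPart L v M ℓ).card ≤ A.card) (hA2 : A.card < (upperPart L v' M ℓ).card)
    {x z : V} (hx : x ∈ S) (hz : z ∈ A) (hxz : x ∈ A → x = z)
    (hc : ∀ a ∈ A, ∀ b ∈ S, b ∉ A → G.Adj a b → a = z) :
    ∃ φ, IsEmb G H S φ (upperPart L p M ℓ) ∧ L (φ x) = ℓ ∧ L (φ z) = ℓ := by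
  have hvv := card_upperPart_anti (L := L) (M := M) (ℓ := ℓ) hpv'
  have hpM : p ≤ M := by
    by_contra h
    have : (upperPart L v' M ℓ).card = 0 := by
      rw [Finset.card_eq_zero]; ext i; simp only [mem_upperPart]; simp; omega
    omega
  obtain ⟨q, hpq, hqM, hq⟩ := exists_card_upperPart_eq (L := L) (ℓ := ℓ) hpM
    (n := A.card) (by omega)
  have hqv : q ≤ v := le_of_card_upperPart_le hvM hv.ge (by omega)
  have hvq : v' < q := lt_of_card_upperPart_lt (L := L) (M := M) (ℓ := ℓ) (by omega)
  have hsum := card_upperPart_add (L := L) (ℓ := ℓ) hpq hqM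
  have hsd := Finset.card_sdiff_add_card_eq_card hA
  have hApos : 0 < A.card := Finset.card_pos.2 ⟨z, hz⟩
  have hBpos : 0 < (S \ A).card := by omega
  obtain ⟨f, hf, hfz⟩ := (hF A.card (by omega)).exists_level_eq hl hM (hK.mono hpq le_rfl) rfl hq
    hz le_rfl hqv hvM hv
  obtain ⟨w, hw⟩ := Finset.card_pos.1 hBpos
  obtain ⟨x', hx'B, hx'⟩ : ∃ x' ∈ S \ A, x ∉ A → x' = x := by
    by_cases h : x ∈ A
    · exact ⟨w, hw, fun h' => absurd h h'⟩
    · exact ⟨x, by simp [hx, h], fun _ => rfl⟩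
  obtain ⟨g, hg, hgx⟩ := (hF (S \ A).card (by omega)).exists_level_eq hl (by omega)
    (hK.mono le_rfl hqM) rfl (by omega) hx'B le_rfl hpv' hvq hv'
  have hfz' := mem_upperPart.1 (hf.2.1 z hz)
  obtain ⟨φ, h1, h2, h3⟩ := IsEmb.glue hf hg disjoint_upperPart (upperPart_union hpq hqM) (by
    intro a ha b hb hbA hab
    obtain rfl := hc a ha b hb hbA hab
    have hgb := mem_upperPart.1 (hg.2.1 b (by simp [hb, hbA]))
    refine hL.adj_of_lt hM hK hl (mem_upperPart.2 ⟨by omega, by omega, by omega⟩)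
      (mem_upperPart.2 ⟨by omega, by omega, by omega⟩) (by omega) (by omega))
  have hz' : L (φ z) = ℓ := by rw [h2 z hz]; omega
  refine ⟨φ, h1, ?_, hz'⟩
  by_cases h : x ∈ A
  · rw [hxz h, hz']
  · rw [h3 x h, ← hx' h]
    have := mem_upperPart.1 (hg.2.1 x' hx'B)
    omega

end embedding

section leaf

variable {V : Type*} {G : SimpleGraph V}

theorem exists_leaf_ne (hG : G.IsAcyclic) {S : Finset V} (hS : 2 ≤ S.card) (x : V) :
    ∃ y ∈ S, y ≠ x ∧ ∃ w ∈ S, w ≠ y ∧ ∀ b ∈ S, G.Adj y b → b = w := by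
  classical
  have hcard : Fintype.card S = S.card := Fintype.card_coe S
  have : Nontrivial S := Fintype.one_lt_card_iff_nontrivial.1 (by omega)
  obtain ⟨T, hT, hTm⟩ := SimpleGraph.exists_maximal_isAcyclic_of_le_isAcyclic
    (G := (⊤ : SimpleGraph S)) le_top (hG.induce (S : Set V))
  have hT' : T.IsTree :=
    SimpleGraph.maximal_isAcyclic_iff_isTree.1 ⟨hTm.1.2, fun T' h1 h2 => hTm.2 ⟨le_top, h1⟩ h2⟩
  obtain ⟨y, hyx, hy⟩ : ∃ y : S, (y : V) ≠ x ∧ T.degree y = 1 := by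
    obtain ⟨u, w, huw, hu, hw⟩ := hT'.exists_ne_and_degree_eq_one
    by_cases h : (u : V) = x
    · exact ⟨w, fun h' => huw (Subtype.ext (h.trans h'.symm)), hw⟩
    · exact ⟨u, h, hu⟩
  obtain ⟨w, hw, huniq⟩ := SimpleGraph.degree_eq_one_iff_existsUnique_adj.1 hy
  refine ⟨y, y.2, hyx, w, w.2, fun h => hw.ne (Subtype.ext h.symm), fun b hb hab => ?_⟩
  exact congrArg Subtype.val (huniq ⟨b, hb⟩ (hT hab))

end leaf

/-- A rooting at `x` of a forest containing all edges of `G` inside `S`. -/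
structure Rooting {V : Type*} (G : SimpleGraph V) (S : Finset V) (x : V) (par : V → V)
    (rk : V → ℕ) : Prop where
  mem : x ∈ S
  par_self : par x = x
  par_mem : ∀ v ∈ S, par v ∈ S
  rk_lt : ∀ v ∈ S, v ≠ x → rk (par v) < rk v
  adj : ∀ a ∈ S, ∀ b ∈ S, G.Adj a b → (a ≠ x ∧ par a = b) ∨ (b ≠ x ∧ par b = a)

theorem exists_rooting {V : Type*} [DecidableEq V] {G : SimpleGraph V} (hG : G.IsAcyclic) {n : ℕ} :
    ∀ {S : Finset V}, S.card = n → ∀ {x : V}, x ∈ S → ∃ par rk, Rooting G S x par rk := by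
  induction n with
  | zero => intro S hS x hx; simp only [Finset.card_eq_zero] at hS; simp [hS] at hx
  | succ n ih =>
    intro S hS x hx
    by_cases hn : n = 0
    · subst hn
      obtain ⟨y, rfl⟩ := Finset.card_eq_one.1 hS
      simp only [Finset.mem_singleton] at hx
      subst hx
      refine ⟨id, fun _ => 0, by simp, rfl, by simp, by simp, ?_⟩
      simp
    · obtain ⟨y, hy, hyx, w, hw, hwy, hadj⟩ := exists_leaf_ne hG (S := S) (by omega) x
      obtain ⟨par, rk, h⟩ := ih (S := S.erase y)
        (by rw [Finset.card_erase_of_mem hy]; omega) (Finset.mem_erase.2 ⟨hyx.symm, hx⟩)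
      have hpar : ∀ v ∈ S, v ≠ y → par v ∈ S ∧ par v ≠ y := fun v hv hvy => by
        have := h.par_mem v (Finset.mem_erase.2 ⟨hvy, hv⟩)
        rw [Finset.mem_erase] at this
        exact this.symm
      refine ⟨fun v => if v = y then w else par v, fun v => if v = y then rk w + 1 else rk v,
        hx, ?_, ?_, ?_, ?_⟩
      · simp [hyx.symm, h.par_self]
      · intro v hv
        by_cases hvy : v = y
        · simp [hvy, hw]
        · simp [hvy, hpar v hv hvy]
      · intro v hv hvx
        by_cases hvy : v = y
        · simp [hvy, hwy]
        · simp [hvy, hpar v hv hvy, h.rk_lt v (Finset.mem_erase.2 ⟨hvy, hv⟩) hvx]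
      · intro a ha b hb hab
        by_cases hay : a = y
        · subst hay
          exact Or.inl ⟨hyx, by simp [hadj b hb hab]⟩
        · by_cases hby : b = y
          · subst hby
            exact Or.inr ⟨hyx, by simp [hadj a ha hab.symm]⟩
          · simp only [hay, hby, if_false]
            exact h.adj a (Finset.mem_erase.2 ⟨hay, ha⟩) b (Finset.mem_erase.2 ⟨hby, hb⟩) hab

open Classical in
/-- The descendants of `z` in `S` under the parent function `par`. -/
noncomputable def descSet {V : Type*} (S : Finset V) (par : V → V) (z : V) : Finset V :=
  S.filter (fun v => ∃ k, par^[k] v = z)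

open Classical in
/-- The children of `z` in `S` under the parent function `par` with root `x`. -/
noncomputable def childSet {V : Type*} (S : Finset V) (x : V) (par : V → V) (z : V) : Finset V :=
  S.filter (fun c => c ≠ x ∧ par c = z)

section descSet

variable {V : Type*} {G : SimpleGraph V} {S : Finset V} {x : V} {par : V → V} {rk : V → ℕ}

theorem mem_descSet {z v : V} : v ∈ descSet S par z ↔ v ∈ S ∧ ∃ k, par^[k] v = z := by
  simp [descSet]

theorem mem_childSet {z c : V} : c ∈ childSet S x par z ↔ c ∈ S ∧ c ≠ x ∧ par c = z := by
  simp [childSet]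

theorem descSet_subset {z : V} : descSet S par z ⊆ S := fun _ h => (mem_descSet.1 h).1

theorem self_mem_descSet {z : V} (hz : z ∈ S) : z ∈ descSet S par z :=
  mem_descSet.2 ⟨hz, 0, rfl⟩

theorem descSet_subset_of_mem {z h : V} (hh : h ∈ descSet S par z) :
    descSet S par h ⊆ descSet S par z := by
  intro v hv
  obtain ⟨-, k, hk⟩ := mem_descSet.1 hh
  obtain ⟨hvS, j, hj⟩ := mem_descSet.1 hv
  exact mem_descSet.2 ⟨hvS, k + j, by rw [Function.iterate_add_apply, hj, hk]⟩

theorem child_mem_descSet {z c : V}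
    (hc : c ∈ childSet S x par z) : c ∈ descSet S par z := by
  obtain ⟨hcS, -, hcz⟩ := mem_childSet.1 hc
  exact mem_descSet.2 ⟨hcS, 1, hcz⟩

namespace Rooting

theorem iterate_mem (h : Rooting G S x par rk) {v : V} (hv : v ∈ S) (k : ℕ) :
    par^[k] v ∈ S := by
  induction k with
  | zero => exact hv
  | succ k ih => rw [Function.iterate_succ_apply']; exact h.par_mem _ ih

theorem rk_iterate_le (h : Rooting G S x par rk) {v : V} (hv : v ∈ S) (k : ℕ) :
    rk (par^[k] v) ≤ rk v := by
  induction k with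
  | zero => exact le_rfl
  | succ k ih =>
    rw [Function.iterate_succ_apply']
    by_cases hx : par^[k] v = x
    · rw [hx, h.par_self, ← hx]; exact ih
    · have := h.rk_lt _ (h.iterate_mem hv k) hx
      omega

theorem descSet_root (h : Rooting G S x par rk) : descSet S par x = S := by
  refine Finset.Subset.antisymm descSet_subset ?_
  suffices ∀ n, ∀ v ∈ S, rk v = n → ∃ k, par^[k] v = x from
    fun v hv => mem_descSet.2 ⟨hv, this _ v hv rfl⟩
  intro n
  induction n using Nat.strong_induction_on with
  | _ n ih =>
    intro v hv hn
    by_cases hx : v = x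
    · exact ⟨0, hx⟩
    · obtain ⟨k, hk⟩ := ih (rk (par v)) (hn ▸ h.rk_lt v hv hx) _ (h.par_mem v hv) rfl
      exact ⟨k + 1, by rw [Function.iterate_succ_apply, hk]⟩

theorem not_mem_descSet_child (h : Rooting G S x par rk) {z c : V}
    (hc : c ∈ childSet S x par z) : z ∉ descSet S par c := by
  intro hz
  obtain ⟨hzS, k, hk⟩ := mem_descSet.1 hz
  obtain ⟨hcS, hcx, rfl⟩ := mem_childSet.1 hc
  have h1 := h.rk_lt c hcS hcx
  have h2 := h.rk_iterate_le hzS k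
  rw [hk] at h2
  omega

theorem root_not_mem_descSet_child (h : Rooting G S x par rk) {z c : V}
    (hc : c ∈ childSet S x par z) : x ∉ descSet S par c := by
  intro hz
  obtain ⟨-, k, hk⟩ := mem_descSet.1 hz
  rw [Function.iterate_fixed h.par_self] at hk
  exact (mem_childSet.1 hc).2.1 hk.symm

theorem descSet_eq_insert [DecidableEq V] (h : Rooting G S x par rk) {z : V} (hz : z ∈ S) :
    descSet S par z = insert z ((childSet S x par z).biUnion (descSet S par)) := by
  ext v
  simp only [Finset.mem_insert, Finset.mem_biUnion]
  constructor
  · intro hv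
    obtain ⟨hvS, k, hk⟩ := mem_descSet.1 hv
    classical
    have hex : ∃ k, par^[k] v = z := ⟨k, hk⟩
    rcases hm : Nat.find hex with _ | m
    · left
      have := Nat.find_spec hex
      rw [hm] at this
      exact this
    · right
      have h1 := Nat.find_spec hex
      have h2 := Nat.find_min hex (m := m) (by omega)
      rw [hm, Function.iterate_succ_apply'] at h1
      refine ⟨par^[m] v, mem_childSet.2 ⟨h.iterate_mem hvS m, ?_, h1⟩,
        mem_descSet.2 ⟨hvS, m, rfl⟩⟩
      intro hx
      rw [hx, h.par_self] at h1
      exact h2 (hx.trans h1)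
  · rintro (rfl | ⟨c, hc, hv⟩)
    · exact self_mem_descSet hz
    · exact descSet_subset_of_mem (child_mem_descSet hc) hv

theorem not_mem_biUnion [DecidableEq V] (h : Rooting G S x par rk) {z : V} {K : Finset V}
    (hK : K ⊆ childSet S x par z) : z ∉ K.biUnion (descSet S par) := by
  simp only [Finset.mem_biUnion, not_exists, not_and]
  exact fun c hc => h.not_mem_descSet_child (hK hc)

theorem disjoint_descSet (h : Rooting G S x par rk) {z c c' : V}
    (hc : c ∈ childSet S x par z) (hc' : c' ∈ childSet S x par z) (hne : c ≠ c') :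
    Disjoint (descSet S par c) (descSet S par c') := by
  rw [Finset.disjoint_left]
  intro v hv hv'
  obtain ⟨hvS, k, hk⟩ := mem_descSet.1 hv
  obtain ⟨-, k', hk'⟩ := mem_descSet.1 hv'
  wlog hle : k ≤ k' generalizing c c' k k'
  · exact this hc' hc hne.symm hv' hv k' hk' k hk (by omega)
  obtain ⟨j, rfl⟩ := Nat.exists_eq_add_of_le' hle
  rw [Function.iterate_add_apply, hk] at hk'
  rcases j with _ | j
  · exact hne hk'
  · rw [Function.iterate_succ_apply, (mem_childSet.1 hc).2.2] at hk'
    refine h.not_mem_descSet_child hc' (mem_descSet.2 ⟨?_, j, hk'⟩)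
    rw [← (mem_childSet.1 hc).2.2]
    exact h.par_mem _ (mem_childSet.1 hc).1

theorem card_insert_biUnion [DecidableEq V] (h : Rooting G S x par rk) {z : V} {K : Finset V}
    (hK : K ⊆ childSet S x par z) :
    (insert z (K.biUnion (descSet S par))).card = 1 + ∑ c ∈ K, (descSet S par c).card := by
  rw [Finset.card_insert_of_notMem (h.not_mem_biUnion hK), Finset.card_biUnion, add_comm]
  exact fun c hc c' hc' hne => h.disjoint_descSet (hK hc) (hK hc') hne

theorem card_descSet [DecidableEq V] (h : Rooting G S x par rk) {z : V} (hz : z ∈ S) :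
    (descSet S par z).card = 1 + ∑ c ∈ childSet S x par z, (descSet S par c).card := by
  conv_lhs => rw [h.descSet_eq_insert hz]
  exact h.card_insert_biUnion (Finset.Subset.refl _)

/-- An edge leaving the descendants of `c` joins `c` to its parent. -/
theorem eq_of_adj (h : Rooting G S x par rk) {c a b : V} (ha : a ∈ descSet S par c)
    (hb : b ∈ S) (hbc : b ∉ descSet S par c) (hab : G.Adj a b) : a = c ∧ b = par c := by
  obtain ⟨haS, k, hk⟩ := mem_descSet.1 ha
  rcases h.adj a haS b hb hab with ⟨-, h1⟩ | ⟨-, h1⟩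
  · rcases k with _ | k
    · have : a = c := hk
      exact ⟨this, by rw [← this, h1]⟩
    · rw [Function.iterate_succ_apply, h1] at hk
      exact absurd (mem_descSet.2 ⟨hb, k, hk⟩) hbc
  · exact absurd (mem_descSet.2 ⟨hb, k + 1, by rw [Function.iterate_succ_apply, h1, hk]⟩) hbc

/-- The edges leaving a set made of `z` and some of the branches below it are at `z`. -/
theorem eq_of_adj_insert_biUnion [DecidableEq V] (h : Rooting G S x par rk) {z : V}
    {K : Finset V} (hK : K ⊆ childSet S x par z) {a b : V}
    (ha : a ∈ insert z (K.biUnion (descSet S par))) (hb : b ∈ S)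
    (hb' : b ∉ insert z (K.biUnion (descSet S par))) (hab : G.Adj a b) : a = z := by
  rw [Finset.mem_insert, not_or] at hb'
  rcases Finset.mem_insert.1 ha with rfl | ha
  · rfl
  · obtain ⟨c, hc, hac⟩ := Finset.mem_biUnion.1 ha
    have hbc : b ∉ descSet S par c := fun hbc => hb'.2 (Finset.mem_biUnion.2 ⟨c, hc, hbc⟩)
    have := (h.eq_of_adj hac hb hbc hab).2
    rw [(mem_childSet.1 (hK hc)).2.2] at this
    exact absurd this hb'.1

theorem root_not_mem_insert [DecidableEq V] (h : Rooting G S x par rk) {z : V}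
    {K : Finset V} (hK : K ⊆ childSet S x par z)
    (hx : x ∈ insert z (K.biUnion (descSet S par))) : x = z := by
  rcases Finset.mem_insert.1 hx with hx | hx
  · exact hx
  · obtain ⟨c, hc, hac⟩ := Finset.mem_biUnion.1 hx
    exact absurd hac (h.root_not_mem_descSet_child (hK hc))

theorem card_child_lt [DecidableEq V] (h : Rooting G S x par rk) {z c : V}
    (hc : c ∈ childSet S x par z) :
    (descSet S par c).card < (descSet S par z).card := by
  refine Finset.card_lt_card ⟨descSet_subset_of_mem (child_mem_descSet hc), fun hs => ?_⟩
  refine h.not_mem_descSet_child hc (hs (self_mem_descSet ?_))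
  rw [← (mem_childSet.1 hc).2.2]
  exact h.par_mem _ (mem_childSet.1 hc).1

/-- A minimal vertex below `k` with a large set of descendants. -/
theorem exists_minimal [DecidableEq V] (h : Rooting G S x par rk) {k : V} (hk : k ∈ S) {m : ℕ}
    (hm : m ≤ (descSet S par k).card) :
    ∃ z ∈ descSet S par k, m ≤ (descSet S par z).card ∧
      ∀ c ∈ childSet S x par z, (descSet S par c).card < m := by
  obtain ⟨z, hz, hmin⟩ := Finset.exists_min_image
    ((descSet S par k).filter fun z => m ≤ (descSet S par z).card)
    (fun z => (descSet S par z).card) ⟨k, by simp [self_mem_descSet hk, hm]⟩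
  rw [Finset.mem_filter] at hz
  refine ⟨z, hz.1, hz.2, fun c hc => ?_⟩
  by_contra hcm
  have h1 := hmin c (Finset.mem_filter.2
    ⟨descSet_subset_of_mem hz.1 (child_mem_descSet hc), by omega⟩)
  have h2 := h.card_child_lt hc
  omega

end Rooting

end descSet

/-- Greedy choice of a subfamily with sum in a short interval. -/
theorem Finset.exists_subset_sum_mem_interval {V : Type*} [DecidableEq V] (f : V → ℕ)
    {s t j : ℕ} (hs : s < t + j) {K : Finset V} (hf : ∀ c ∈ K, f c ≤ j) (ht : t ≤ s + ∑ c ∈ K, f c) :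
    ∃ K' ⊆ K, t ≤ s + ∑ c ∈ K', f c ∧ s + ∑ c ∈ K', f c < t + j := by
  induction K using Finset.induction_on with
  | empty => exact ⟨∅, by simp, by simpa using ht, by simpa using hs⟩
  | insert a K ha ih =>
    by_cases h : t ≤ s + ∑ c ∈ K, f c
    · obtain ⟨K', h1, h2⟩ := ih (fun c hc => hf c (by simp [hc])) h
      exact ⟨K', h1.trans (Finset.subset_insert _ _), h2⟩
    · refine ⟨insert a K, Finset.Subset.refl _, ht, ?_⟩
      rw [Finset.sum_insert ha]
      have := hf a (by simp)
      omega

section piece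

variable {V : Type*} [DecidableEq V] {G : SimpleGraph V} {S : Finset V} {x : V} {par : V → V}
  {rk : V → ℕ}

/-- Removing some branches at `h` from the branch at `k`. -/
theorem Rooting.sdiff_biUnion_spec (hR : Rooting G S x par rk) {z k h : V}
    (hk : k ∈ childSet S x par z) (hh : h ∈ descSet S par k) {K : Finset V}
    (hK : K ⊆ childSet S x par h) {A : Finset V}
    (hA : A = descSet S par k \ K.biUnion (descSet S par)) :
    h ∈ A ∧ A.card + ∑ c ∈ K, (descSet S par c).card = (descSet S par k).card ∧
      ∀ a ∈ A, ∀ b ∈ S, b ∉ A → G.Adj a b → a = h ∨ (a = k ∧ b = z) := by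
  subst hA
  have hsub : K.biUnion (descSet S par) ⊆ descSet S par k := by
    rw [Finset.biUnion_subset]
    exact fun c hc => (descSet_subset_of_mem (child_mem_descSet (hK hc))).trans
      (descSet_subset_of_mem hh)
  refine ⟨Finset.mem_sdiff.2 ⟨hh, hR.not_mem_biUnion hK⟩, ?_, ?_⟩
  · have h1 := hR.card_insert_biUnion hK
    rw [Finset.card_insert_of_notMem (hR.not_mem_biUnion hK)] at h1
    have h2 := Finset.card_sdiff_add_card_eq_card hsub
    omega
  · intro a ha b hb hbA hab
    rw [Finset.mem_sdiff] at ha hbA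
    by_cases hbk : b ∈ descSet S par k
    · left
      have hbK : b ∈ K.biUnion (descSet S par) := by
        by_contra h'
        exact hbA ⟨hbk, h'⟩
      obtain ⟨c, hc, hbc⟩ := Finset.mem_biUnion.1 hbK
      have hac : a ∉ descSet S par c := fun h' => ha.2 (Finset.mem_biUnion.2 ⟨c, hc, h'⟩)
      rw [(hR.eq_of_adj hbc (descSet_subset ha.1) hac hab.symm).2, (mem_childSet.1 (hK hc)).2.2]
    · right
      have := hR.eq_of_adj ha.1 hb hbk hab
      rwa [(mem_childSet.1 hk).2.2] at this

/-- A piece of controlled size inside the branch at `k`, attached to the rest essentially at a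
single vertex `h`. -/
theorem Rooting.exists_piece (hR : Rooting G S x par rk) {z k : V}
    (hk : k ∈ childSet S x par z) {β b : ℕ} (hb : 2 ≤ b) (hβ1 : 1 ≤ β)
    (hβ : β ≤ (descSet S par k).card) (hβ4 : (descSet S par k).card + β ≤ 4 * b) :
    ∃ h A, A ⊆ descSet S par k ∧ h ∈ A ∧ β ≤ A.card ∧ A.card + 2 ≤ β + b ∧
      ∀ a ∈ A, ∀ b ∈ S, b ∉ A → G.Adj a b → a = h ∨ (a = k ∧ b = z ∧ 2 ≤ β) := by
  have hkS := (mem_childSet.1 hk).1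
  by_cases hβb : β ≤ b
  · obtain ⟨h, hh, hh1, hh2⟩ := hR.exists_minimal hkS hβ
    have hhS := descSet_subset hh
    rw [hR.card_descSet hhS] at hh1
    obtain ⟨K, hK, h1, h2⟩ := Finset.exists_subset_sum_mem_interval
      (fun c => (descSet S par c).card) (s := 1) (t := β) (j := b - 1) (by omega)
      (fun c hc => by have := hh2 c hc; omega) hh1
    rw [← hR.card_insert_biUnion hK] at h1 h2
    refine ⟨h, _, ?_, Finset.mem_insert_self _ _, h1, by omega,
      fun a ha b hb hbA hab => Or.inl (hR.eq_of_adj_insert_biUnion hK ha hb hbA hab)⟩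
    rw [Finset.insert_subset_iff, Finset.biUnion_subset]
    exact ⟨hh, fun c hc => (descSet_subset_of_mem (child_mem_descSet (hK hc))).trans
      (descSet_subset_of_mem hh)⟩
  · obtain ⟨h, hh, hh1, hh2⟩ := hR.exists_minimal hkS
      (m := (descSet S par k).card - β + 1) (by omega)
    have hhS := descSet_subset hh
    suffices ∃ K ⊆ childSet S x par h,
        β + ∑ c ∈ K, (descSet S par c).card ≤ (descSet S par k).card ∧
        (descSet S par k).card + 2 ≤ β + b + ∑ c ∈ K, (descSet S par c).card by
      obtain ⟨K, hK, h1, h2⟩ := this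
      obtain ⟨h3, h4, h5⟩ := hR.sdiff_biUnion_spec hk hh hK rfl
      refine ⟨h, _, Finset.sdiff_subset, h3, by omega, by omega, fun a ha b' hb' hbA hab => ?_⟩
      rcases h5 a ha b' hb' hbA hab with h6 | h6
      · exact Or.inl h6
      · exact Or.inr ⟨h6.1, h6.2, by omega⟩
    by_cases hbig : ∃ c ∈ childSet S x par h, b ≤ (descSet S par c).card
    · obtain ⟨c, hc, hcb⟩ := hbig
      have := hh2 c hc
      exact ⟨{c}, by simpa using hc, by rw [Finset.sum_singleton]; omega,
        by rw [Finset.sum_singleton]; omega⟩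
    · push Not at hbig
      have hcard := hR.card_descSet hhS
      have hle := Finset.card_le_card (descSet_subset_of_mem hh)
      obtain ⟨K, hK, h1, h2⟩ := Finset.exists_subset_sum_mem_interval
        (fun c => (descSet S par c).card)
        (s := (descSet S par k).card - (descSet S par h).card + 1) (t := β) (j := b - 1)
        (by omega) (fun c hc => by have := hbig c hc; omega) (by omega)
      have h3 := Finset.sum_sdiff hK (f := fun c => (descSet S par c).card)
      refine ⟨childSet S x par h \ K, Finset.sdiff_subset, ?_, ?_⟩ <;> omega

end piece

section main

variable {V : Type*} [DecidableEq V] {G : SimpleGraph V} {L : ℕ → ℕ} {N : ℕ}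
  {H : SimpleGraph ℕ} {S : Finset V} {x : V} {par : V → V} {rk : V → ℕ}

theorem LayeredGraph.exists_succ_level (hL : LayeredGraph L N H) {v M ℓ : ℕ} (hM : M ≤ N)
    (hv : L v = ℓ) (huniq : ∀ c, v < c → c < M → L c ≠ ℓ)
    (h2 : 2 ≤ (upperPart L v M ℓ).card) : ∃ u, v ≤ u ∧ u < M ∧ L u = ℓ + 1 := by
  obtain ⟨w, hw, hwv⟩ := Finset.exists_mem_ne (show 1 < (upperPart L v M ℓ).card by omega) v
  rw [mem_upperPart] at hw
  have := huniq w (by omega) (by omega)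
  obtain ⟨c, h1, h2, h3⟩ := hL.exists_level_eq hw.1 (by omega) (by omega : L v ≤ ℓ + 1)
    (by omega)
  exact ⟨c, h1, by omega, h3⟩

theorem exists_isEmb_of_two (hL : LayeredGraph L N H) (hF : ∀ k < S.card, Fills G L N H k)
    (hR : Rooting G S x par rk) {ℓ p v v' : ℕ} (hl : 1 ≤ ℓ) (hpv' : p ≤ v') (hvv : v' < v)
    (hv : L v = ℓ) (hv' : L v' = ℓ) {z : V} (n : ℕ) :
    ∀ {K U : Finset V} {M : ℕ}, K.card = n → M ≤ N → SingleGap L p M ℓ → v < M →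
      (∀ c, p ≤ c → c < M → L c = ℓ → c = v' ∨ c = v) → U ⊆ S →
      U.card = (upperPart L p M ℓ).card → z ∈ U → x ∈ U → K ⊆ childSet S x par z →
      (∀ c ∈ K, descSet S par c ⊆ U) →
      (∀ c ∈ K, (descSet S par c).card < (upperPart L v M ℓ).card) →
      (upperPart L v M ℓ).card ≤ 1 + ∑ c ∈ K, (descSet S par c).card →
      ∃ φ, IsEmb G H U φ (upperPart L p M ℓ) ∧ L (φ x) = ℓ ∧ L (φ z) ≤ ℓ + 1 := by
  induction n using Nat.strong_induction_on with
  | _ n ih =>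
  intro K U M hKn hM hgap hvM huniq hUS hU hz hx hK hKU hKm hsum
  have hUc := Finset.card_le_card hUS
  have hLast : LastAt L v M ℓ := ⟨hvM, hv, fun c h1 h2 h3 => by
    have := huniq c (by omega) h2 h3; omega⟩
  have hCons : ConsecAt L v' v ℓ := ⟨hvv, hv', hv, fun c h1 h2 h3 => by
    have := huniq c (by omega) (by omega) h3; omega⟩
  have hmb := card_upperPart_add (L := L) (ℓ := ℓ) hvv.le hvM.le
  have hpM := card_upperPart_anti (L := L) (M := M) (ℓ := ℓ) hpv'
  have h4 := hL.four_mul v' v M ℓ hM hCons hLast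
  have hb1 := card_upperPart_lt (L := L) (ℓ := ℓ) hvv (hvv.trans hvM) hv'.ge
  by_cases hsmall : ∀ c ∈ K, (descSet S par c).card ≤ (upperPart L v' v ℓ).card
  · obtain ⟨K', hK', h1, h2⟩ := Finset.exists_subset_sum_mem_interval
      (fun c => (descSet S par c).card) (s := 1) (t := (upperPart L v M ℓ).card)
      (j := (upperPart L v' v ℓ).card) (by
        have := card_upperPart_lt (L := L) (ℓ := ℓ) (q := M) hvM hvM hv.ge
        omega) hsmall hsum
    rw [← hR.card_insert_biUnion (hK'.trans hK)] at h1 h2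
    obtain ⟨φ, h5, h6, h7⟩ := exists_isEmb_of_hub hL (x := x) (z := z)
      (A := insert z (K'.biUnion (descSet S par))) (fun k hk => hF k (by omega)) hl hM hgap hpv'
      hvM hv hv' hU (by
        rw [Finset.insert_subset_iff, Finset.biUnion_subset]
        exact ⟨hz, fun c hc => hKU c (hK' hc)⟩) h1 (by omega) hx (Finset.mem_insert_self _ _)
      (hR.root_not_mem_insert (hK'.trans hK))
      (fun a ha b hb hbA hab => hR.eq_of_adj_insert_biUnion (hK'.trans hK) ha (hUS hb) hbA hab)
    exact ⟨φ, h5, h6, by omega⟩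
  push Not at hsmall
  obtain ⟨y, hyK, hymax⟩ := Finset.exists_max_image K (fun c => (descSet S par c).card)
    (by obtain ⟨c, hc, -⟩ := hsmall; exact ⟨c, hc⟩)
  have hyb : (upperPart L v' v ℓ).card < (descSet S par y).card := by
    obtain ⟨c, hc, hcb⟩ := hsmall
    exact hcb.trans_le (hymax c hc)
  have hym := hKm y hyK
  have hyz := hK hyK
  have hyS := (mem_childSet.1 hyz).1
  have hypar := (mem_childSet.1 hyz).2.2
  have hb2 := hL.two_le v' v M ℓ hM hCons hLast (by omega)
  have hpvM : p ≤ M := by omega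
  obtain ⟨M1, hM1p, hM1M, hM1⟩ := exists_card_upperPart_eq (L := L) (ℓ := ℓ) hpvM
    (n := (descSet S par y).card)
    (by have := card_upperPart_anti (L := L) (M := M) (ℓ := ℓ) (hpv'.trans hvv.le); omega)
  have hvM1 : v < M1 := lt_of_card_upperPart_lt (L := L) (M := M) (ℓ := ℓ) (by omega)
  have hβ := card_upperPart_add (L := L) (ℓ := ℓ) hvM1.le hM1M
  have hUM1 := card_upperPart_add (L := L) (ℓ := ℓ) hM1p hM1M
  have hsd := Finset.card_sdiff_add_card_eq_card (hKU y hyK)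
  have hzy : z ∉ descSet S par y := hR.not_mem_descSet_child hyz
  have hxy : x ∉ descSet S par y := hR.root_not_mem_descSet_child hyz
  obtain ⟨f, hf, hfy⟩ : ∃ f, IsEmb G H (descSet S par y) f (upperPart L M1 M ℓ) ∧
      L (f y) ≤ ℓ + 1 := by
    obtain ⟨u, hu, huL⟩ := exists_lastAt (hL.exists_succ_level hM hv hLast.2.2 (by omega))
    have h1 := hL.next_level v' v u M ℓ (by omega) hM hCons huL
    have hvu : v < u := by
      have := huL.2.1
      rcases hu.lt_or_eq with h | h
      · exact h
      · subst h; omega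
    have h2 : upperPart L u M (ℓ + 1) = upperPart L u M ℓ := by
      ext i
      simp only [mem_upperPart]
      constructor
      · omega
      · rintro ⟨h2, h3, h4⟩
        have := hLast.2.2 i (by omega) h3
        omega
    rw [h2] at h1
    have hM1u : M1 ≤ u := le_of_card_upperPart_le (L := L) (ℓ := ℓ) huL.1
      (by have := huL.2.1; omega) (by omega)
    exact (hF _ (by omega)).exists_level_eq hl hM (hgap.mono hM1p le_rfl) rfl hM1
      (self_mem_descSet hyS) (by omega) hM1u huL.1 huL.2.1
  suffices ∃ g, IsEmb G H (U \ descSet S par y) g (upperPart L p M1 ℓ) ∧ L (g x) = ℓ ∧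
      L (g z) ≤ ℓ + 1 by
    obtain ⟨g, hg, hgx, hgz⟩ := this
    obtain ⟨φ, h1, h2, h3⟩ := IsEmb.glue hf hg disjoint_upperPart
      (upperPart_union hM1p hM1M) (by
        intro a ha b hb hbA hab
        obtain ⟨rfl, rfl⟩ := hR.eq_of_adj ha (hUS hb) hbA hab
        rw [hypar]
        have hfa := mem_upperPart.1 (hf.2.1 a ha)
        have hgb := mem_upperPart.1 (hg.2.1 z (by simp [hz, hzy]))
        exact hL.adj_of_near hM hgap hl (mem_upperPart.2 ⟨by omega, by omega, by omega⟩)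
          (mem_upperPart.2 ⟨by omega, by omega, by omega⟩) (by omega) hfy hgz)
    exact ⟨φ, h1, by rw [h3 x hxy, hgx], by rw [h3 z hzy]; exact hgz⟩
  have hzU : z ∈ U \ descSet S par y := by simp [hz, hzy]
  have hxU : x ∈ U \ descSet S par y := by simp [hx, hxy]
  have hbranch : ∀ c ∈ K.erase y, descSet S par c ⊆ U \ descSet S par y := by
    intro c hc
    rw [Finset.mem_erase] at hc
    rw [Finset.subset_sdiff]
    exact ⟨hKU c hc.2, hR.disjoint_descSet (hK hc.2) hyz hc.1⟩
  have hsumy := Finset.add_sum_erase K (fun c => (descSet S par c).card) hyK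
  by_cases hrest : ∀ c ∈ K.erase y, (descSet S par c).card < (upperPart L v M1 ℓ).card
  · exact ih (K.erase y).card (hKn ▸ Finset.card_erase_lt_of_mem hyK) rfl (hM1M.trans hM)
      (hgap.mono le_rfl hM1M) hvM1 (fun c h1 h2 => huniq c h1 (by omega))
      (Finset.sdiff_subset.trans hUS) (by omega) hzU hxU ((Finset.erase_subset _ _).trans hK)
      hbranch hrest (by omega)
  push Not at hrest
  obtain ⟨k, hkK, hkβ⟩ := hrest
  have hkz := hK (Finset.mem_of_mem_erase hkK)
  have hkS := (mem_childSet.1 hkz).1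
  have hky := hymax k (Finset.mem_of_mem_erase hkK)
  have hβ1 := card_upperPart_lt (L := L) (ℓ := ℓ) hvM1 hvM1 hv.ge
  obtain ⟨h, A, hAk, hhA, hA1, hA2, hA3⟩ := hR.exists_piece hkz (β := (upperPart L v M1 ℓ).card)
    hb2 (by omega) hkβ (by omega)
  have hAU : A ⊆ U \ descSet S par y := hAk.trans (hbranch k hkK)
  have hAU' := Finset.card_sdiff_add_card_eq_card hAU
  have hzA : z ∉ A := fun h => hR.not_mem_descSet_child hkz (hAk h)
  have hxA : x ∉ A := fun h => hR.root_not_mem_descSet_child hkz (hAk h)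
  have hM1N : M1 ≤ N := hM1M.trans hM
  have hmb1 := card_upperPart_add (L := L) (ℓ := ℓ) hvv.le hvM1.le
  have hpM1 := card_upperPart_anti (L := L) (M := M1) (ℓ := ℓ) hpv'
  have hA0 : 0 < A.card := Finset.card_pos.2 ⟨h, hhA⟩
  obtain ⟨M2, hM2p, hM2M1, hM2⟩ := exists_card_upperPart_eq (L := L) (ℓ := ℓ) hM1p
    (n := A.card) (by omega)
  have hM2v : M2 ≤ v := le_of_card_upperPart_le hvM1 hv.ge (by omega)
  have hv'M2 : v' < M2 := lt_of_card_upperPart_lt (L := L) (M := M1) (ℓ := ℓ) (by omega)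
  have hsplit := card_upperPart_add (L := L) (ℓ := ℓ) hM2p hM2M1
  have hsplit' := card_upperPart_add (L := L) (ℓ := ℓ) hv'M2.le hM2M1
  have hgap1 := hgap.mono (p' := p) le_rfl hM1M
  obtain ⟨k', hk'A, hk'⟩ : ∃ k' ∈ A, k ∈ A → k' = k := by
    by_cases hkA : k ∈ A
    · exact ⟨k, hkA, fun _ => rfl⟩
    · exact ⟨h, hhA, fun h' => absurd h' hkA⟩
  obtain ⟨f', hf', hf'h, hf'k⟩ := exists_isEmb_of_unique hL (v := v) (y := k')
    (fun j hj => hF j (by omega)) hl hM1N (hgap1.mono hM2p le_rfl) hM2v hvM1 hv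
    (fun c h1 h2 h3 => by have := huniq c (by omega) (by omega) h3; omega) hM2.symm hhA hk'A
  obtain ⟨g', hg', hg'x, hg'z⟩ := exists_isEmb_of_unique hL (v := v') (x := x) (y := z)
    (S := (U \ descSet S par y) \ A) (p := p) (M := M2) (ℓ := ℓ)
    (fun j hj => hF j (by omega)) hl (by omega) (hgap1.mono le_rfl hM2M1) hpv' hv'M2 hv'
    (fun c h1 h2 h3 => by have := huniq c (by omega) (by omega) h3; omega) (by omega)
    (Finset.mem_sdiff.2 ⟨hxU, hxA⟩) (Finset.mem_sdiff.2 ⟨hzU, hzA⟩)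
  have hg'z' : L (g' z) ≤ ℓ + 1 := by
    obtain ⟨u, h1, h2, h3⟩ := hL.exists_succ_level (M := M2) (by omega) hv'
      (fun c h1 h2 h3 => by have := huniq c (by omega) (by omega) h3; omega) (by omega)
    exact hg'z ⟨u, by omega, h2, h3⟩
  obtain ⟨ψ, h1, h2, h3⟩ := IsEmb.glue hf' hg' disjoint_upperPart
    (upperPart_union hM2p hM2M1) (by
      intro a ha b hb hbA hab
      have hfa := mem_upperPart.1 (hf'.2.1 a ha)
      have hgb := mem_upperPart.1 (hg'.2.1 b (by simpa [hbA] using hb))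
      have hfa' : f' a ∈ upperPart L p M1 ℓ := mem_upperPart.2 ⟨by omega, by omega, by omega⟩
      have hgb' : g' b ∈ upperPart L p M1 ℓ := mem_upperPart.2 ⟨by omega, by omega, by omega⟩
      rcases hA3 a ha b (hUS (Finset.sdiff_subset hb)) hbA hab with rfl | ⟨rfl, rfl, hβ2⟩
      · exact hL.adj_of_lt hM1N hgap1 hl hfa' hgb' (by omega) hf'h
      · refine hL.adj_of_near hM1N hgap1 hl hfa' hgb' (by omega) ?_ hg'z'
        rw [← hk' ha]
        obtain ⟨u, h1, h2, h3⟩ := hL.exists_succ_level hM1N hv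
          (fun c h1 h2 h3 => by have := huniq c (by omega) (by omega) h3; omega) hβ2
        exact hf'k ⟨u, by omega, h2, h3⟩)
  exact ⟨ψ, h1, by rw [h3 x hxA, hg'x], by rw [h3 z hzA]; exact hg'z'⟩

theorem fills_of_isAcyclic (hL : LayeredGraph L N H) (hG : G.IsAcyclic) (n : ℕ) :
    Fills G L N H n := by
  induction n using Nat.strong_induction_on with
  | _ n ih =>
  intro ℓ₀ p M hl₀ hM hgap₀ S hSn hXn x hx
  have hSpos : 0 < S.card := Finset.card_pos.2 ⟨x, hx⟩
  obtain ⟨w, hw, hmin⟩ := exists_mem_upperPart_min (Finset.card_pos.1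
    (by omega : 0 < (upperPart L p M ℓ₀).card))
  have hw' := mem_upperPart.1 hw
  obtain ⟨ℓ, hℓ⟩ : ∃ ℓ, L w = ℓ := ⟨_, rfl⟩
  rw [hℓ] at hmin hw'
  have hX : upperPart L p M ℓ₀ = upperPart L p M ℓ := by
    ext i
    rw [mem_upperPart, mem_upperPart]
    constructor
    · intro hi; exact ⟨hi.1, hi.2.1, hmin i (mem_upperPart.2 hi)⟩
    · omega
  have hgap : SingleGap L p M ℓ := by
    rcases hw'.2.2.eq_or_lt with h | h
    · exact h ▸ hgap₀
    · intro u u' h1 h2 h3 h4 h5 h6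
      have := hmin u (mem_upperPart.2 ⟨h1, h2, by omega⟩)
      omega
  suffices ∃ φ, IsEmb G H S φ (upperPart L p M ℓ) ∧ L (φ x) = ℓ by
    obtain ⟨φ, h1, h2⟩ := this
    exact ⟨φ, hX ▸ h1, fun u hu => h2.trans_le (hmin u hu)⟩
  have hl : 1 ≤ ℓ := by omega
  rw [hX] at hXn
  subst hSn
  clear hmin hX hgap₀ hw
  obtain ⟨v, hpv, hv⟩ := exists_lastAt ⟨w, hw'.1, hw'.2.1, hℓ⟩
  by_cases hv'ex : ∃ v', p ≤ v' ∧ v' < v ∧ L v' = ℓ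
  swap
  · obtain ⟨φ, h1, h2, -⟩ := exists_isEmb_of_unique hL ih hl hM hgap hpv hv.1 hv.2.1
      (fun c h1 h2 h3 => by
        by_contra h
        rcases lt_or_gt_of_ne h with h | h
        · exact hv'ex ⟨c, h1, h, h3⟩
        · exact hv.2.2 c h h2 h3) hXn.symm hx hx
    exact ⟨φ, h1, h2⟩
  obtain ⟨v', hpv', hv'⟩ := exists_lastAt hv'ex
  have hmb := card_upperPart_add (L := L) (ℓ := ℓ) hv'.1.le hv.1.le
  have hpM := card_upperPart_anti (L := L) (M := M) (ℓ := ℓ) hpv'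
  obtain ⟨par, rk, hR⟩ := exists_rooting hG rfl hx
  obtain ⟨z, hz, hzm, hzc⟩ := hR.exists_minimal hx (m := (upperPart L v M ℓ).card)
    (by rw [hR.descSet_root]; omega)
  have hzS := descSet_subset hz
  rw [hR.card_descSet hzS] at hzm
  by_cases hex : ∃ v'', p ≤ v'' ∧ v'' < v' ∧ L v'' = ℓ
  · obtain ⟨v'', hpv'', hv''⟩ := exists_lastAt hex
    have hmb' := card_upperPart_add (L := L) (ℓ := ℓ) (hv''.1.trans hv'.1).le hv.1.le
    have hmb'' := card_upperPart_add (L := L) (ℓ := ℓ) hv''.1.le hv'.1.le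
    have hb1 := card_upperPart_lt (L := L) (ℓ := ℓ) hv'.1 hv'.1 hv'.2.1.ge
    have htwo := hL.sum_two v'' v' v M ℓ hM ⟨hv''.1, hv''.2.1, hv'.2.1, hv''.2.2⟩
      ⟨hv'.1, hv'.2.1, hv.2.1, hv'.2.2⟩ hv
    obtain ⟨K, hK, h1, h2⟩ := Finset.exists_subset_sum_mem_interval
      (fun c => (descSet S par c).card) (s := 1) (t := (upperPart L v M ℓ).card)
      (j := (upperPart L v'' v ℓ).card) (by
        have := card_upperPart_lt (L := L) (ℓ := ℓ) hv.1 hv.1 hv.2.1.ge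
        omega) (fun c hc => by have := hzc c hc; omega) hzm
    rw [← hR.card_insert_biUnion hK] at h1 h2
    obtain ⟨φ, h5, h6, -⟩ := exists_isEmb_of_hub hL (x := x) (z := z) (S := S)
      (A := insert z (K.biUnion (descSet S par))) ih hl hM hgap hpv''
      hv.1 hv.2.1 hv''.2.1 hXn.symm (by
        rw [Finset.insert_subset_iff, Finset.biUnion_subset]
        exact ⟨hzS, fun c hc => descSet_subset⟩) h1 (by omega) hx (Finset.mem_insert_self _ _)
      (hR.root_not_mem_insert hK)
      (fun a ha b hb hbA hab => hR.eq_of_adj_insert_biUnion hK ha hb hbA hab)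
    exact ⟨φ, h5, h6⟩
  · obtain ⟨φ, h1, h2, -⟩ := exists_isEmb_of_two hL ih hR hl hpv' hv'.1 hv.2.1 hv'.2.1 (z := z) _
      (K := childSet S x par z) rfl hM hgap hv.1 (fun c h1 h2 h3 => by
        by_contra! h
        rcases lt_or_gt_of_ne h.1 with h' | h'
        · exact hex ⟨c, h1, h', h3⟩
        · rcases lt_or_gt_of_ne h.2 with h'' | h''
          · exact hv'.2.2 c h' h'' h3
          · exact hv.2.2 c h'' h2 h3) (Finset.Subset.refl S) hXn.symm hzS hx
      (Finset.Subset.refl _) (fun c _ => descSet_subset) hzc hzm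
    exact ⟨φ, h1, h2⟩

end main

namespace DFSTree

variable {N : ℕ} (T : DFSTree N)

theorem parent_le {j : ℕ} (hj : j < N) : T.parent j ≤ j := by
  rcases Nat.eq_zero_or_pos j with rfl | h
  · exact T.parent_zero.le
  · exact (T.parent_lt j h hj).le

theorem iterate_parent_le {j : ℕ} (hj : j < N) (k : ℕ) : T.parent^[k] j ≤ j := by
  induction k with
  | zero => exact le_rfl
  | succ k ih =>
    rw [Function.iterate_succ_apply']
    exact (T.parent_le (by omega)).trans ih

theorem exists_iterate_parent_eq_zero {j : ℕ} (hj : j < N) : ∃ k, T.parent^[k] j = 0 := by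
  induction j using Nat.strong_induction_on with
  | _ j ih =>
    rcases Nat.eq_zero_or_pos j with rfl | h
    · exact ⟨0, rfl⟩
    · have := T.parent_lt j h hj
      obtain ⟨k, hk⟩ := ih _ this (by omega)
      exact ⟨k + 1, by rw [Function.iterate_succ_apply, hk]⟩

theorem level_zero : T.level 0 = 0 :=
  Nat.le_zero.1 (Nat.sInf_le (show T.parent^[0] 0 = 0 from rfl))

theorem iterate_parent_level {j : ℕ} (hj : j < N) : T.parent^[T.level j] j = 0 :=
  Nat.sInf_mem (s := {k | T.parent^[k] j = 0}) (T.exists_iterate_parent_eq_zero hj)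

theorem level_le_of_iterate {j k : ℕ} (h : T.parent^[k] j = 0) : T.level j ≤ k :=
  Nat.sInf_le (s := {k | T.parent^[k] j = 0}) h

theorem eq_zero_of_level {j : ℕ} (hj : j < N) (h : T.level j = 0) : j = 0 := by
  have := T.iterate_parent_level hj
  rwa [h] at this

theorem level_eq {j : ℕ} (h0 : 0 < j) (hj : j < N) :
    T.level j = T.level (T.parent j) + 1 := by
  have hp := T.parent_lt j h0 hj
  apply le_antisymm
  · apply T.level_le_of_iterate
    rw [Function.iterate_succ_apply]
    exact T.iterate_parent_level (by omega)
  · have h1 := T.iterate_parent_level hj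
    rcases hk : T.level j with _ | k
    · exact absurd (T.eq_zero_of_level hj hk) h0.ne'
    · rw [hk, Function.iterate_succ_apply] at h1
      have := T.level_le_of_iterate h1
      omega

theorem level_iterate {j : ℕ} (hj : j < N) (k : ℕ) :
    T.level (T.parent^[k] j) = T.level j - k := by
  induction k with
  | zero => rfl
  | succ k ih =>
    rw [Function.iterate_succ_apply']
    have hle := T.iterate_parent_le hj k
    rcases Nat.eq_zero_or_pos (T.parent^[k] j) with h | h
    · rw [h] at ih ⊢
      rw [T.parent_zero, T.level_zero] at *
      omega
    · have := T.level_eq h (by omega)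
      omega

theorem level_succ_le (i : ℕ) (hi : i + 1 < N) : T.level (i + 1) ≤ T.level i + 1 := by
  obtain ⟨k, hk⟩ := T.preorder_chain (i + 1) (by omega) hi
  rw [T.level_eq (by omega) hi, ← hk, Nat.add_sub_cancel, T.level_iterate (by omega)]
  omega

theorem iterate_parent_eq {u w : ℕ} (huw : u ≤ w) (hw : w < N)
    (h : ∀ c, u < c → c ≤ w → T.level u < T.level c) :
    T.parent^[T.level w - T.level u] w = u := by
  induction w using Nat.strong_induction_on with
  | _ w ih =>
    rcases huw.eq_or_lt with rfl | hlt
    · rw [Nat.sub_self]; rfl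
    · have hp := T.parent_lt w (by omega) hw
      have hl := T.level_eq (j := w) (by omega) hw
      have hw' := h w hlt le_rfl
      by_cases hup : u ≤ T.parent w
      · have := ih _ hp hup (by omega) (fun c h1 h2 => h c h1 (by omega))
        rw [show T.level w - T.level u = (T.level (T.parent w) - T.level u) + 1 by omega,
          Function.iterate_succ_apply, this]
      · exfalso
        obtain ⟨k, hk⟩ := T.preorder_chain w (by omega) hw
        have h1 := ih (w - 1) (by omega) (by omega) (by omega)
          (fun c h1 h2 => h c h1 (by omega))
        have h2 := T.level_iterate (j := w - 1) (by omega) k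
        rw [hk] at h2
        have h3 : T.level u ≤ T.level (w - 1) := by
          have := T.level_iterate (j := w - 1) (by omega) (T.level (w - 1) - T.level u)
          rw [h1] at this
          omega
        by_cases hk' : k ≤ T.level (w - 1) - T.level u
        · rw [show T.level (w - 1) - T.level u = (T.level (w - 1) - T.level u - k) + k by omega,
            Function.iterate_add_apply, hk] at h1
          have := T.iterate_parent_le (j := T.parent w) (by omega)
            (T.level (w - 1) - T.level u - k)
          omega
        · have h4 : u = 0 := T.eq_zero_of_level (by omega) (by omega)
          omega

theorem level_lt_of_iterate {w : ℕ} (hw : w < N) {k c : ℕ} (hc : T.parent^[k] w < c)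
    (hcw : c ≤ w) : T.level (T.parent^[k] w) < T.level c := by
  induction w using Nat.strong_induction_on generalizing k c with
  | _ w ih =>
    rcases k with _ | k
    · simp only [Function.iterate_zero, id] at hc; omega
    · have hw0 : 0 < w := by omega
      have hp := T.parent_lt w hw0 hw
      have hl := T.level_eq hw0 hw
      have hle := T.level_iterate (j := T.parent w) (by omega) k
      rw [Function.iterate_succ_apply] at hc ⊢
      by_cases h1 : c ≤ T.parent w
      · exact ih _ hp (by omega) hc h1
      · rcases hcw.eq_or_lt with rfl | h2
        · omega
        · obtain ⟨j, hj⟩ := T.preorder_chain w hw0 hw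
          have := ih (w - 1) (by omega) (by omega) (k := j) (c := c) (by omega) (by omega)
          rw [hj] at this
          omega

theorem mem_descCl {u w : ℕ} :
    w ∈ T.descCl u ↔ w < N ∧ u ≤ w ∧ ∀ c, u < c → c ≤ w → T.level u < T.level c := by
  constructor
  · rintro ⟨hw, k, rfl⟩
    exact ⟨hw, T.iterate_parent_le hw k, fun c h1 h2 => T.level_lt_of_iterate hw h1 h2⟩
  · rintro ⟨hw, huw, h⟩
    exact ⟨hw, _, T.iterate_parent_eq huw hw h⟩

theorem finite_descCl (u : ℕ) : (T.descCl u).Finite :=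
  (Set.finite_lt_nat N).subset fun _ h => h.1

/-- The ancestor at level `i`. -/
theorem exists_ancestor {w i : ℕ} (hw : w < N) (hi : i ≤ T.level w) :
    ∃ s, s ≤ w ∧ T.level s = i ∧ w ∈ T.descCl s ∧
      ∀ c, s < c → c ≤ w → i < T.level c := by
  have h1 := T.level_iterate hw (T.level w - i)
  have h2 : w ∈ T.descCl (T.parent^[T.level w - i] w) := ⟨hw, _, rfl⟩
  refine ⟨_, T.iterate_parent_le hw _, by omega, h2, ?_⟩
  rw [show i = T.level (T.parent^[T.level w - i] w) by omega]
  convert (T.mem_descCl.1 h2).2.2 using 5; omega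

theorem upperPart_subset_descCl {v M : ℕ} (hM : M ≤ N)
    (h : ∀ c, v < c → c < M → T.level c ≠ T.level v) :
    (upperPart T.level v M (T.level v) : Set ℕ) ⊆ T.descCl v := by
  intro w hw
  have hw' := mem_upperPart.1 (Finset.mem_coe.1 hw)
  refine T.mem_descCl.2 ⟨by omega, hw'.1, fun c h1 h2 => ?_⟩
  by_contra hc
  obtain ⟨d, h3, h4, h5⟩ := exists_level_eq_of_step T.level_succ_le h2 (by omega)
    (by omega : T.level c ≤ T.level v) hw'.2.2
  exact h d (by omega) (by omega) h5

theorem card_upperPart_le {v M ℓ : ℕ} (hM : M ≤ N) (h : LastAt T.level v M ℓ) :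
    (upperPart T.level v M ℓ).card ≤ (T.descCl v).ncard := by
  obtain ⟨-, rfl, h3⟩ := h
  rw [← Set.ncard_coe_finset]
  exact Set.ncard_le_ncard (T.upperPart_subset_descCl hM h3) (T.finite_descCl v)

theorem descCl_eq_upperPart {a b ℓ : ℕ} (hb : b < N) (h : ConsecAt T.level a b ℓ) :
    T.descCl a = upperPart T.level a b ℓ := by
  obtain ⟨hab, rfl, hlb, h4⟩ := h
  refine Set.Subset.antisymm ?_ (T.upperPart_subset_descCl hb.le h4)
  intro w hw
  obtain ⟨h1, h2, h3⟩ := T.mem_descCl.1 hw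
  rw [Finset.mem_coe, mem_upperPart]
  refine ⟨h2, ?_, ?_⟩
  · by_contra h
    have := h3 b hab (by omega)
    omega
  · rcases h2.eq_or_lt with rfl | h
    · exact le_rfl
    · exact (h3 w h le_rfl).le

theorem ncard_descCl {a b ℓ : ℕ} (hb : b < N) (h : ConsecAt T.level a b ℓ) :
    (T.descCl a).ncard = (upperPart T.level a b ℓ).card := by
  rw [T.descCl_eq_upperPart hb h, Set.ncard_coe_finset]

theorem nlc_of_consecAt {a b ℓ : ℕ} (h : ConsecAt T.level a b ℓ) : T.Nlc b a := by
  obtain ⟨h1, h2, h3, h4⟩ := h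
  exact ⟨h1, by omega, fun c h5 h6 => by rw [h3]; exact h4 c h5 h6⟩

theorem adj_of_arc {h u w : ℕ} (hne : u ≠ w) (hu : u < N) (hw : w < N) (ha : T.Arc h u w) :
    (T.graph h).Adj u w := by
  rw [graph, SimpleGraph.fromRel_adj]
  exact ⟨hne, Or.inl ⟨hu, hw, ha⟩⟩

theorem adj_of_descendant {h u w : ℕ} (huw : u < w) (hw : w < N)
    (hd : ∀ c, u < c → c ≤ w → T.level u < T.level c) : (T.graph h).Adj u w :=
  T.adj_of_arc huw.ne (by omega) hw (Or.inl ⟨T.mem_descCl.2 ⟨hw, huw.le, hd⟩, huw.ne'⟩)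

theorem adj_of_left {h u w : ℕ} (hwu : w < u) (hu : u < N) (hle : T.level u ≤ T.level w)
    (hgap : ∀ c c', w < c → c ≤ u → w < c' → c' ≤ u → T.level c + 1 = T.level u →
      T.level c' + 1 = T.level u → c = c') : (T.graph h).Adj u w := by
  have hu0 : 0 < u := by omega
  have hw : w < N := by omega
  have hpu := T.parent_lt u hu0 hu
  have hlu := T.level_eq hu0 hu
  have hdu : ∀ c, T.parent u < c → c ≤ u → T.level (T.parent u) < T.level c :=
    fun c h1 h2 => T.level_lt_of_iterate hu (k := 1) h1 h2
  refine T.adj_of_arc hwu.ne' hu hw ?_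
  by_cases hq : T.parent u ≤ w
  · obtain ⟨s, hsw, hs, hws, hds⟩ := T.exists_ancestor hw hle
    have hqs : T.parent u < s := by
      by_contra hc
      rcases (not_lt.1 hc).eq_or_lt with h1 | h1
      · rw [← h1] at hlu; omega
      · have := hds _ h1 hq
        omega
    have hps := T.iterate_parent_eq hqs.le (by omega) (fun c h1 h2 => hdu c h1 (by omega))
    rw [show T.level s - T.level (T.parent u) = 1 by omega] at hps
    refine Or.inr (Or.inl ⟨s, ⟨by omega, by omega, hps⟩, ?_⟩)
    by_cases h : w = s
    · exact Or.inl h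
    · exact Or.inr ⟨hws, h⟩
  · push Not at hq
    obtain ⟨t, htw, ht, hwt, hdt⟩ := T.exists_ancestor hw (by omega : T.level (T.parent u) ≤ _)
    refine Or.inr (Or.inr (Or.inl ⟨hu0, t, ⟨by omega, ht, ?_⟩, Or.inr ⟨hwt, ?_⟩⟩))
    · intro c h1 h2 h3
      by_cases hcw : c ≤ w
      · have := hdt c h1 hcw
        omega
      · have := hgap c (T.parent u) (by omega) (by omega) hq hpu.le (by omega) (by omega)
        omega
    · rintro rfl; omega

theorem adj_of_near {u w : ℕ} (huw : u ≠ w) (hu : u < N) (hw : w < N) (hl : 2 ≤ T.level u)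
    (hle : T.level w ≤ T.level u) (hle' : T.level u ≤ T.level w + 1)
    (hgap : ∀ c c', min u w < c → c ≤ max u w → min u w < c' → c' ≤ max u w →
      T.level c + 2 = T.level u → T.level c' + 2 = T.level u → c = c') :
    (T.graph 2).Adj u w := by
  have hu'le := T.iterate_parent_le hu 2
  have hlu' := T.level_iterate hu 2
  have hdu : ∀ c, T.parent^[2] u < c → c ≤ u → T.level (T.parent^[2] u) < T.level c :=
    fun c h1 h2 => T.level_lt_of_iterate hu h1 h2
  obtain ⟨w', hw'w, hlw', hww', hdw⟩ := T.exists_ancestor (i := T.level u - 2) hw (by omega)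
  have hstrict : T.StrictDesc w' w := ⟨hww', by rintro rfl; omega⟩
  refine T.adj_of_arc huw hu hw (Or.inr (Or.inr (Or.inr (Or.inr (Or.inr (Or.inr ⟨?_, hle⟩))))))
  rcases lt_trichotomy w' (T.parent^[2] u) with h | h | h
  · have h1 : w < T.parent^[2] u := by
      by_contra h'
      have := hdw _ h (by omega)
      omega
    refine Or.inl ⟨w', ⟨h, by omega, fun c h2 h3 h4 => ?_⟩, hstrict⟩
    by_cases hcw : c ≤ w
    · have := hdw c h2 hcw
      omega
    · have := hgap c (T.parent^[2] u) (by omega) (by omega) (by omega) (by omega) (by omega)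
        (by omega)
      omega
  · exact Or.inr (Or.inl (h ▸ hstrict))
  · have h1 : u < w' := by
      by_contra h'
      have := hdu _ h (by omega)
      omega
    refine Or.inr (Or.inr ⟨w', ⟨h, by omega, by omega, fun c h2 h3 h4 => ?_⟩, hstrict⟩)
    by_cases hcu : c ≤ u
    · have := hdu c h2 hcu
      omega
    · have := hgap c w' (by omega) (by omega) (by omega) (by omega) (by omega) (by omega)
      omega

theorem layeredGraph (hT : T.IsKSTree 4 1) : LayeredGraph T.level N (T.graph 2) where
  step := T.level_succ_le
  adj_desc u w huw hw h := T.adj_of_descendant huw hw h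
  adj_left u w hwu hu _ := T.adj_of_left hwu hu
  adj_near u w := T.adj_of_near
  sum_two a b c M ℓ hM hab hbc hc := by
    have hcM := hc.1
    have hbc' := hbc.1
    have h := (hT c (by omega)).1 b a (T.nlc_of_consecAt hbc) (T.nlc_of_consecAt hab)
    rw [T.ncard_descCl (by omega) hab, T.ncard_descCl (by omega) hbc] at h
    exact (T.card_upperPart_le hM hc).trans h
  four_mul a b M ℓ hM hab hb := by
    have hbM := hb.1
    have h := (hT b (by omega)).2.1 a (T.nlc_of_consecAt hab)
    rw [T.ncard_descCl (by omega) hab] at h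
    exact (T.card_upperPart_le hM hb).trans h
  next_level a b u M ℓ hb hM hab hu := by
    have huM := hu.1
    have hla := hab.2.1
    have hlb := hab.2.2.1
    have hlu := hu.2.1
    have hab' := hab.1
    have h := (hT a (by omega)).2.2.1 ⟨b, hab.1, hb, by omega⟩ u (by omega) (by omega)
    rw [T.ncard_descCl hb hab] at h
    exact (T.card_upperPart_le hM hu).trans h
  two_le a b M ℓ hM hab hb h2 := by
    have hbM := hb.1
    have hab' := hab.1
    obtain ⟨w, hw, hwb⟩ := Finset.exists_mem_ne (by omega : 1 < (upperPart T.level b M ℓ).card) b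
    have hwd : w ∈ T.descCl b := by
      obtain ⟨-, rfl, h3⟩ := hb
      exact T.upperPart_subset_descCl hM h3 hw
    obtain ⟨h1, h3, h4⟩ := T.mem_descCl.1 hwd
    have h5 := h4 (b + 1) (by omega) (by omega)
    have h6 := T.level_succ_le b (by omega)
    have h7 := T.iterate_parent_eq (u := b) (w := b + 1) (by omega) (by omega)
      (fun c h8 h9 => h4 c h8 (by omega))
    rw [show T.level (b + 1) - T.level b = 1 by omega] at h7
    obtain ⟨c, hc0, hcN, hca⟩ := (hT b (by omega)).2.2.2 ⟨b + 1, by omega, by omega, h7⟩ a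
      (T.nlc_of_consecAt hab)
    have hac := T.parent_lt c hc0 hcN
    have hca' : c ∈ T.descCl a := ⟨hcN, 1, hca⟩
    have haa : a ∈ T.descCl a := ⟨by omega, 0, rfl⟩
    rw [T.descCl_eq_upperPart (by omega) hab, Finset.mem_coe] at hca' haa
    exact Finset.one_lt_card.2 ⟨a, haa, c, hca', by omega⟩

end DFSTree

/-- The main embedding lemma. Let `T` be an `N`-vertex `(4,1)`-tree with root `0`. For every
forest `F` on `n' ≤ N` vertices and all vertices `x₁, x₂` of `F` there is a `T`-admissible
embedding `φ` of `F` into `G²_T` (its image is the suffix `{N - n', …, N-1}` of the DFS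
preorder, so that the non-image is an admissible prefix) such that:
(Φ1) `L (φ x₁)` is minimum among all `L (φ u)`; and
(Φ2) if the root has exactly `2` children and `v_t` is its last (largest) child and
`N - 2 ≥ n' ≥ ν v_t ≥ 2`, then `L (φ x₂) ≤ 2`. -/
theorem statement6 (N : ℕ) (hN : 1 ≤ N) (T : DFSTree N) (hT : T.IsKSTree 4 1)
    (n' : ℕ) (hn' : n' ≤ N) (F : SimpleGraph (Fin n')) (hF : F.IsAcyclic)
    (x1 x2 : Fin n') :
    ∃ φ : Fin n' → ℕ, Function.Injective φ ∧ (∀ a, N - n' ≤ φ a ∧ φ a < N) ∧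
      (∀ a b, F.Adj a b → (T.graph 2).Adj (φ a) (φ b)) ∧
      (∀ u : Fin n', T.level (φ x1) ≤ T.level (φ u)) ∧
      ({c : ℕ | 0 < c ∧ c < N ∧ T.parent c = 0}.ncard = 2 →
        ∀ vt : ℕ, 0 < vt → vt < N → T.parent vt = 0 →
          (∀ c, 0 < c → c < N → T.parent c = 0 → c ≤ vt) →
          2 ≤ (T.descCl vt).ncard → (T.descCl vt).ncard ≤ n' → n' ≤ N - 2 →
          T.level (φ x2) ≤ 2) := by
  have hL := T.layeredGraph hT
  have hFill := fills_of_isAcyclic (G := F) hL hF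
  have hlev : ∀ i, 0 < i → i < N → 1 ≤ T.level i := fun i h1 h2 => by
    have := T.level_eq h1 h2
    omega
  have hX : ∀ p, 0 < p → upperPart T.level p N 1 = Finset.Ico p N := fun p hp => by
    ext i
    rw [mem_upperPart, Finset.mem_Ico]
    exact ⟨fun h => ⟨h.1, h.2.1⟩, fun h => ⟨h.1, h.2, hlev i (by omega) h.2⟩⟩
  have hgap : ∀ p, 0 < p → SingleGap T.level p N 1 := fun p hp u u' h1 h2 _ _ h3 _ => by
    have := hlev u (by omega) h2
    omega
  have hpos : 0 < n' := x1.pos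
  have hcard : (Finset.univ : Finset (Fin n')).card = n' := by simp
  rcases hn'.eq_or_lt with rfl | hlt
  · obtain ⟨g, hg⟩ : ∃ g, IsEmb F (T.graph 2) (Finset.univ \ {x1}) g
        (upperPart T.level 1 n' 1) := by
      rcases (Finset.univ \ {x1}).eq_empty_or_nonempty with he | ⟨y, hy⟩
      · rw [he]
        exact ⟨fun _ => 0, by simp [IsEmb]⟩
      · obtain ⟨g, hg, -⟩ := hFill (n' - 1) 1 1 n' le_rfl le_rfl (hgap 1 one_pos)
          (Finset.univ \ {x1}) (by rw [Finset.card_sdiff_of_subset (by simp)]; simp)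
          (by rw [hX 1 one_pos]; simp) y hy
        exact ⟨g, hg⟩
    obtain ⟨φ, h1, h2, h3⟩ := IsEmb.glue (isEmb_singleton x1 0) hg
      (Z := Finset.range n') (by
        rw [Finset.disjoint_singleton_left, mem_upperPart]; omega) (by
        rw [hX 1 one_pos]; ext i; simp; omega) (by
        intro a _ b hb hbx _
        have hgb := mem_upperPart.1 (hg.2.1 b (by simpa using hbx))
        refine T.adj_of_descendant (by omega) hgb.2.1 fun c h1 h2 => ?_
        rw [T.level_zero]
        exact hlev c h1 (by omega))
    refine ⟨φ, fun a b hab => h1.1 (by simp) (by simp) hab, fun a => ?_,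
      fun a b hab => h1.2.2 a (by simp) b (by simp) hab, fun u => ?_, fun _ vt _ _ _ _ _ _ h => ?_⟩
    · have := h1.2.1 a (by simp)
      rw [Finset.mem_range] at this
      omega
    · rw [h2 x1 (by simp), T.level_zero]
      exact Nat.zero_le _
    · omega
  · have hp : 0 < N - n' := by omega
    have hXc : (upperPart T.level (N - n') N 1).card = n' := by
      rw [hX _ hp, Nat.card_Ico]; omega
    suffices ∃ φ, IsEmb F (T.graph 2) Finset.univ φ (upperPart T.level (N - n') N 1) ∧
        (∀ u ∈ upperPart T.level (N - n') N 1, T.level (φ x1) ≤ T.level u) ∧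
        ({c : ℕ | 0 < c ∧ c < N ∧ T.parent c = 0}.ncard = 2 →
        ∀ vt : ℕ, 0 < vt → vt < N → T.parent vt = 0 →
          (∀ c, 0 < c → c < N → T.parent c = 0 → c ≤ vt) →
          2 ≤ (T.descCl vt).ncard → (T.descCl vt).ncard ≤ n' → n' ≤ N - 2 →
          T.level (φ x2) ≤ 2) by
      obtain ⟨φ, h1, h2, h3⟩ := this
      refine ⟨φ, fun a b hab => h1.1 (by simp) (by simp) hab, fun a => ?_,
        fun a b hab => h1.2.2 a (by simp) b (by simp) hab,
        fun u => h2 _ (h1.2.1 u (by simp)), h3⟩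
      have := mem_upperPart.1 (h1.2.1 a (by simp))
      omega
    by_cases hP : {c : ℕ | 0 < c ∧ c < N ∧ T.parent c = 0}.ncard = 2 ∧ n' ≤ N - 2 ∧
        ∃ vt, 0 < vt ∧ vt < N ∧ T.parent vt = 0 ∧
          (∀ c, 0 < c → c < N → T.parent c = 0 → c ≤ vt) ∧
          2 ≤ (T.descCl vt).ncard ∧ (T.descCl vt).ncard ≤ n'
    swap
    · obtain ⟨φ, h1, h2⟩ := hFill n' 1 (N - n') N le_rfl le_rfl (hgap _ hp) Finset.univ hcard
        hXc x1 (Finset.mem_univ _)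
      exact ⟨φ, h1, h2, fun h3 vt h4 h5 h6 h7 h8 h9 h10 =>
        absurd ⟨h3, h10, vt, h4, h5, h6, h7, h8, h9⟩ hP⟩
    · obtain ⟨htwo, hn2, vt, hvt0, hvtN, hvt, hmax, hν2, hνn⟩ := hP
      have hlvt : T.level vt = 1 := by rw [T.level_eq hvt0 hvtN, hvt, T.level_zero]
      have hroot : ∀ c, 0 < c → c < N → T.level c = 1 → T.parent c = 0 := fun c h1 h2 h3 => by
        have h4 := T.level_eq h1 h2
        have h5 := T.parent_lt c h1 h2
        exact T.eq_zero_of_level (by omega) (by omega)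
      have hlast : ∀ c, vt < c → c < N → T.level c ≠ 1 := fun c h1 h2 h3 => by
        have := hmax c (by omega) h2 (hroot c (by omega) h2 h3)
        omega
      have hν : (T.descCl vt).ncard = N - vt := by
        have : T.descCl vt = (Finset.Ico vt N : Set ℕ) := by
          ext w
          rw [T.mem_descCl, Finset.mem_coe, Finset.mem_Ico]
          refine ⟨fun h => ⟨h.2.1, h.1⟩, fun h => ⟨h.2, h.1, fun c h1 h2 => ?_⟩⟩
          have h3 := hlev c (by omega) (by omega)
          have h4 := hlast c h1 (by omega)
          omega
        rw [this, Set.ncard_coe_finset, Nat.card_Ico]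
      have huniq : ∀ c, N - n' ≤ c → c < N → T.level c = 1 → c = vt := by
        intro c h1 h2 h3
        obtain ⟨a, b, hab, hset⟩ := Set.ncard_eq_two.1 htwo
        have hmem : ∀ c, 0 < c → c < N → T.parent c = 0 → c = a ∨ c = b := fun c h4 h5 h6 => by
          have h7 : c ∈ {c : ℕ | 0 < c ∧ c < N ∧ T.parent c = 0} := ⟨h4, h5, h6⟩
          rw [hset] at h7
          simpa using h7
        have h4 := hmem c (by omega) h2 (hroot c (by omega) h2 h3)
        have h5 := hmem vt hvt0 hvtN hvt
        have h6 := hmem 1 one_pos (by omega) (by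
          have := T.parent_lt 1 one_pos (by omega)
          omega)
        omega
      obtain ⟨φ, h1, h2, h3⟩ := exists_isEmb_of_unique hL (G := F) (S := Finset.univ)
        (fun k _ => hFill k) le_rfl le_rfl (hgap _ hp) (v := vt) (by omega) hvtN hlvt huniq
        (hcard.trans hXc.symm) (Finset.mem_univ x1) (Finset.mem_univ x2)
      refine ⟨φ, h1, fun u hu => ?_, fun _ _ _ _ _ _ _ _ _ => h3 ⟨vt + 1, by omega, by omega, ?_⟩⟩
      · rw [h2]
        exact (mem_upperPart.1 hu).2.2
      · have h4 := T.level_succ_le vt (by omega)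
        have h5 := hlast (vt + 1) (by omega) (by omega)
        have h6 := hlev (vt + 1) (by omega) (by omega)
        omega
end

section
/- For every integer n ≥ 1, every n-vertex simple graph that is interval-universal for trees has at least n·log₂ n − 4·n·√(log₂ n) edges. -/
/-- An `n`-vertex graph `G` is interval-universal for trees: there is an ordering
`x 0, …, x (n-1)` of its vertices (a permutation of `Fin n`) such that for all `i, m` with
`i + m ≤ n`, the induced subgraph on `{x i, …, x (i+m-1)}` contains every tree on `m`
vertices. -/
def IntervalUniversal {n : ℕ} (G : SimpleGraph (Fin n)) : Prop :=
  ∃ x : Equiv.Perm (Fin n), ∀ i m : ℕ, i + m ≤ n →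
    ∀ T : SimpleGraph (Fin m), T.IsTree →
      ∃ f : Fin m → Fin n, Function.Injective f ∧
        (∀ a, ∃ j : Fin n, i ≤ (j : ℕ) ∧ (j : ℕ) < i + m ∧ f a = x j) ∧
        (∀ a b, T.Adj a b → G.Adj (f a) (f b))

/-- The pairs `a < b` in `[i, i + m)` related by `H`. -/
noncomputable def relPairs (H : ℕ → ℕ → Prop) (i m : ℕ) : Finset (ℕ × ℕ) := by
  classical exact
    {p ∈ Finset.Ico i (i + m) ×ˢ Finset.Ico i (i + m) | p.1 < p.2 ∧ H p.1 p.2}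

theorem mem_relPairs {H : ℕ → ℕ → Prop} {i m : ℕ} {p : ℕ × ℕ} :
    p ∈ relPairs H i m ↔ i ≤ p.1 ∧ p.1 < p.2 ∧ p.2 < i + m ∧ H p.1 p.2 := by
  simp only [relPairs, Finset.mem_filter, Finset.mem_product, Finset.mem_Ico]
  constructor
  · rintro ⟨⟨⟨h1, h2⟩, h3, h4⟩, h5, h6⟩
    exact ⟨h1, h5, h4, h6⟩
  · rintro ⟨h1, h5, h4, h6⟩
    exact ⟨⟨⟨h1, by omega⟩, by omega, h4⟩, h5, h6⟩

/-- Splitting an interval of length `a + 1 + b` at a vertex related to all the others. -/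
theorem card_relPairs_split {H : ℕ → ℕ → Prop} {i a b : ℕ}
    (hl : ∀ u, i ≤ u → u < i + a → H u (i + a))
    (hr : ∀ u, i + a < u → u < i + (a + 1 + b) → H (i + a) u) :
    (relPairs H i a).card + (relPairs H (i + a + 1) b).card + (a + b) ≤
      (relPairs H i (a + 1 + b)).card := by
  classical
  set L : Finset (ℕ × ℕ) := (Finset.Ico i (i + a)).image fun u => (u, i + a) with hL
  set R : Finset (ℕ × ℕ) := (Finset.Ico (i + a + 1) (i + (a + 1 + b))).image
    fun u => (i + a, u) with hR
  have cL : L.card = a := by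
    rw [hL, Finset.card_image_of_injective _ (fun u v h => (Prod.ext_iff.1 h).1)]
    simp
  have cR : R.card = b := by
    rw [hR, Finset.card_image_of_injective _ (fun u v h => (Prod.ext_iff.1 h).2),
      Nat.card_Ico]
    omega
  have mL : ∀ p, p ∈ L ↔ i ≤ p.1 ∧ p.1 < i + a ∧ p.2 = i + a := by
    rintro ⟨p, q⟩
    simp [hL, and_assoc, eq_comm]
  have mR : ∀ p, p ∈ R ↔ i + a < p.2 ∧ p.2 < i + (a + 1 + b) ∧ p.1 = i + a := by
    rintro ⟨p, q⟩
    simp [hR, and_assoc, eq_comm]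
  have d1 : Disjoint (relPairs H i a) (relPairs H (i + a + 1) b) := by
    rw [Finset.disjoint_left]
    intro p hp hq
    rw [mem_relPairs] at hp hq
    omega
  have d2 : Disjoint L R := by
    rw [Finset.disjoint_left]
    intro p hp hq
    rw [mL] at hp
    rw [mR] at hq
    omega
  have d3 : Disjoint (relPairs H i a ∪ relPairs H (i + a + 1) b) (L ∪ R) := by
    rw [Finset.disjoint_left]
    intro p hp hq
    rw [Finset.mem_union, mem_relPairs, mem_relPairs] at hp
    rw [Finset.mem_union, mL, mR] at hq
    omega
  have hsub : (relPairs H i a ∪ relPairs H (i + a + 1) b) ∪ (L ∪ R) ⊆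
      relPairs H i (a + 1 + b) := by
    rintro ⟨p, q⟩ hp
    simp only [Finset.mem_union, mem_relPairs, mL, mR] at hp ⊢
    rcases hp with (⟨h1, h2, h3, h4⟩ | ⟨h1, h2, h3, h4⟩) | ⟨h1, h2, rfl⟩ | ⟨h1, h2, rfl⟩
    · exact ⟨h1, h2, by omega, h4⟩
    · exact ⟨by omega, h2, by omega, h4⟩
    · exact ⟨h1, h2, by omega, hl _ h1 h2⟩
    · exact ⟨by omega, h1, h2, hr _ h1 h2⟩
  have := Finset.card_le_card hsub
  rw [Finset.card_union_of_disjoint d3, Finset.card_union_of_disjoint d1,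
    Finset.card_union_of_disjoint d2, cL, cR] at this
  omega

theorem add_mul_logb_two_add_le {p q : ℝ} (hp : 0 < p) (hq : 0 < q) :
    (p + q) * Real.logb 2 (p + q) - (p + q) ≤ p * Real.logb 2 p + q * Real.logb 2 q := by
  have h := Real.convexOn_mul_log.2 (Set.mem_Ici.2 hp.le) (Set.mem_Ici.2 hq.le)
    (by norm_num : (0 : ℝ) ≤ 1 / 2) (by norm_num : (0 : ℝ) ≤ 1 / 2) (by norm_num)
  simp only [smul_eq_mul] at h
  have h2 : 0 < Real.log 2 := Real.log_pos (by norm_num)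
  have e : 1 / 2 * p + 1 / 2 * q = (p + q) / 2 := by ring
  rw [e, Real.log_div (by positivity) (by norm_num)] at h
  simp only [Real.logb]
  rw [← sub_nonneg]
  have e2 : p * (Real.log p / Real.log 2) + q * (Real.log q / Real.log 2) -
      ((p + q) * (Real.log (p + q) / Real.log 2) - (p + q)) =
      (p * Real.log p + q * Real.log q - ((p + q) * (Real.log (p + q) - Real.log 2))) /
        Real.log 2 := by
    field_simp
  rw [e2]
  apply div_nonneg _ h2.le
  linarith

/-- If every nonempty interval in `[0, n)` has an element related to all others, then each
interval of length `m` carries at least as many related pairs as the total depth of a balanced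
binary tree on `m` nodes. -/
theorem le_card_relPairs {H : ℕ → ℕ → Prop} {n : ℕ}
    (hH : ∀ i m, 0 < m → i + m ≤ n → ∃ v, i ≤ v ∧ v < i + m ∧
      (∀ u, i ≤ u → u < v → H u v) ∧ (∀ u, v < u → u < i + m → H v u)) (m : ℕ) :
    ∀ i, i + m ≤ n →
      ((m : ℝ) + 1) * Real.logb 2 (m + 1) - 2 * m ≤ ((relPairs H i m).card : ℝ) := by
  induction m using Nat.strong_induction_on with
  | _ m ih =>
    intro i him
    rcases Nat.eq_zero_or_pos m with rfl | hm
    · simp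
    obtain ⟨v, h1, h2, hl, hr⟩ := hH i m hm him
    obtain ⟨a, rfl⟩ := Nat.exists_eq_add_of_le h1
    obtain ⟨b, rfl⟩ := Nat.exists_eq_add_of_le (by omega : a + 1 ≤ m)
    have ha := ih a (by omega) i (by omega)
    have hb := ih b (by omega) (i + a + 1) (by omega)
    have hs : ((relPairs H i a).card : ℝ) + (relPairs H (i + a + 1) b).card + (a + b) ≤
        (relPairs H i (a + 1 + b)).card := by
      exact_mod_cast card_relPairs_split hl hr
    have hc := add_mul_logb_two_add_le (p := (a : ℝ) + 1) (q := (b : ℝ) + 1)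
      (by positivity) (by positivity)
    have e : (((a + 1 + b : ℕ) : ℝ) + 1) = (a + 1) + (b + 1) := by push_cast; ring
    rw [e]
    push_cast
    linarith

/-- In an interval-universal ordering every nonempty interval has a vertex adjacent to all the
others. -/
theorem exists_forall_adj_of_universal {n : ℕ} {G : SimpleGraph (Fin n)} {x : Equiv.Perm (Fin n)}
    (hx : ∀ i m : ℕ, i + m ≤ n → ∀ T : SimpleGraph (Fin m), T.IsTree →
      ∃ f : Fin m → Fin n, Function.Injective f ∧
        (∀ a, ∃ j : Fin n, i ≤ (j : ℕ) ∧ (j : ℕ) < i + m ∧ f a = x j) ∧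
        (∀ a b, T.Adj a b → G.Adj (f a) (f b)))
    {i m : ℕ} (hm : 0 < m) (him : i + m ≤ n) :
    ∃ v : Fin n, i ≤ (v : ℕ) ∧ (v : ℕ) < i + m ∧
      ∀ u : Fin n, i ≤ (u : ℕ) → (u : ℕ) < i + m → u ≠ v → G.Adj (x v) (x u) := by
  classical
  obtain ⟨f, hf, hmem, hadj⟩ := hx i m him (SimpleGraph.starGraph (⟨0, hm⟩ : Fin m))
    (SimpleGraph.isTree_starGraph _)
  choose j h1 h2 hj using hmem
  have jinj : Function.Injective fun a => (j a : ℕ) := by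
    intro a b hab
    apply hf
    rw [hj, hj, Fin.ext hab]
  have himg : Finset.univ.image (fun a => (j a : ℕ)) = Finset.Ico i (i + m) := by
    apply Finset.eq_of_subset_of_card_le
    · intro k hk
      obtain ⟨a, -, rfl⟩ := Finset.mem_image.1 hk
      exact Finset.mem_Ico.2 ⟨h1 a, h2 a⟩
    · rw [Finset.card_image_of_injective _ jinj]
      simp
  refine ⟨j ⟨0, hm⟩, h1 _, h2 _, fun u hu1 hu2 hne => ?_⟩
  have hu : (u : ℕ) ∈ Finset.univ.image (fun a => (j a : ℕ)) := by
    rw [himg]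
    exact Finset.mem_Ico.2 ⟨hu1, hu2⟩
  obtain ⟨a, -, ha⟩ := Finset.mem_image.1 hu
  obtain rfl : j a = u := Fin.ext ha
  rw [← hj, ← hj]
  apply hadj
  have : a ≠ ⟨0, hm⟩ := fun h => hne (by rw [h])
  simp [SimpleGraph.starGraph_adj, this.symm]

/-- Sharper form of the bound: the star alone forces `(n + 1) log₂ (n + 1) - 2 n` edges. -/
theorem IntervalUniversal.le_ncard_edgeSet {n : ℕ} (hn : 0 < n) {G : SimpleGraph (Fin n)}
    (hG : IntervalUniversal G) :
    ((n : ℝ) + 1) * Real.logb 2 (n + 1) - 2 * n ≤ (G.edgeSet.ncard : ℝ) := by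
  obtain ⟨x, hx⟩ := hG
  let H : ℕ → ℕ → Prop := fun a b => ∃ (ha : a < n) (hb : b < n), G.Adj (x ⟨a, ha⟩) (x ⟨b, hb⟩)
  have hH : ∀ i m, 0 < m → i + m ≤ n → ∃ v, i ≤ v ∧ v < i + m ∧
      (∀ u, i ≤ u → u < v → H u v) ∧ (∀ u, v < u → u < i + m → H v u) := by
    intro i m hm him
    obtain ⟨v, h1, h2, hv⟩ := exists_forall_adj_of_universal hx hm him
    refine ⟨v, h1, h2, fun u hu1 hu2 => ⟨by omega, v.2, ?_⟩, fun u hu1 hu2 => ⟨v.2, by omega, ?_⟩⟩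
    · exact (hv ⟨u, by omega⟩ hu1 (by simp only; omega)
        (fun h => hu2.ne (congrArg Fin.val h))).symm
    · exact hv ⟨u, by omega⟩ (by simp only; omega) hu2
        (fun h => hu1.ne' (congrArg Fin.val h))
  refine (le_card_relPairs hH n 0 (by omega)).trans ?_
  rw [← Set.ncard_coe_finset]
  rw [Nat.cast_le]
  have key : ∀ p ∈ relPairs H 0 n, ∃ (h1 : p.1 < n) (h2 : p.2 < n),
      p.1 < p.2 ∧ G.Adj (x ⟨p.1, h1⟩) (x ⟨p.2, h2⟩) := by
    intro p hp
    obtain ⟨-, hlt, -, h1, h2, h⟩ := mem_relPairs.1 hp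
    exact ⟨h1, h2, hlt, h⟩
  refine Set.ncard_le_ncard_of_injOn
    (fun p : ℕ × ℕ => if h : p.1 < n ∧ p.2 < n then s(x ⟨p.1, h.1⟩, x ⟨p.2, h.2⟩)
      else s(x ⟨0, hn⟩, x ⟨0, hn⟩)) ?_ ?_ (Set.toFinite G.edgeSet)
  · intro p hp
    obtain ⟨h1, h2, -, h⟩ := key p hp
    simp [h1, h2, h]
  · intro p hp q hq hpq
    obtain ⟨h1, h2, hlt, -⟩ := key p hp
    obtain ⟨h3, h4, hlt', -⟩ := key q hq
    simp only [h1, h2, h3, h4, and_self, dite_true, Sym2.eq_iff, x.injective.eq_iff,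
      Fin.mk.injEq] at hpq
    exact Prod.ext (by omega) (by omega)

/-- Every `n`-vertex graph that is interval-universal for trees has at least
`n·log₂ n − 4·n·√(log₂ n)` edges. -/
theorem statement7 (n : ℕ) (hn : 1 ≤ n) (G : SimpleGraph (Fin n))
    (hG : IntervalUniversal G) :
    (n : ℝ) * Real.logb 2 n - 4 * n * Real.sqrt (Real.logb 2 n) ≤ (G.edgeSet.ncard : ℝ) := by
  refine le_trans ?_ (hG.le_ncard_edgeSet hn)
  have hn' : (1 : ℝ) ≤ n := by exact_mod_cast hn
  have hlog : 0 ≤ Real.logb 2 n := Real.logb_nonneg (by norm_num) hn'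
  rcases hn.eq_or_lt with rfl | h2
  · norm_num
  have h2' : (2 : ℝ) ≤ n := by exact_mod_cast h2
  have hl1 : 1 ≤ Real.logb 2 n := by
    rw [Real.le_logb_iff_rpow_le (by norm_num) (by linarith)]
    simpa using h2'
  have hs : 1 ≤ Real.sqrt (Real.logb 2 n) := Real.one_le_sqrt.2 hl1
  have hmono : Real.logb 2 n ≤ Real.logb 2 (n + 1) :=
    Real.logb_le_logb_of_le (by norm_num) (by linarith) (by linarith)
  have e1 : (n : ℝ) * Real.logb 2 n ≤ (n + 1) * Real.logb 2 (n + 1) :=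
    mul_le_mul (by linarith) hmono hlog (by linarith)
  have e2 : (n : ℝ) * 1 ≤ n * Real.sqrt (Real.logb 2 n) :=
    mul_le_mul_of_nonneg_left hs (by linarith)
  linarith
end

section
/- There is a constant C such that for every integer n ≥ 1 there exists an n-vertex simple graph that is interval-universal for trees and has at most (14/5)·n·log₂ n + C·n edges. -/
section Splitting

variable {V : Type*} [DecidableEq V] {T : SimpleGraph V}

/-- In an acyclic graph, two neighbours of `v` are not connected inside a set avoiding `v`. -/
theorem SimpleGraph.IsAcyclic.eq_of_reachable_induce (hT : T.IsAcyclic) {A : Set V} {v u w : V}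
    (hv : v ∉ A) (hu : u ∈ A) (hw : w ∈ A) (hvu : T.Adj v u) (hvw : T.Adj v w)
    (h : (T.induce A).Reachable ⟨u, hu⟩ ⟨w, hw⟩) : u = w := by
  by_contra hne
  obtain ⟨p⟩ := h
  let p' : T.Walk u w := p.map (SimpleGraph.Embedding.induce A).toHom
  have hp' : ∀ y ∈ p'.support, y ∈ A := by
    intro y hy
    obtain ⟨z, -, rfl⟩ := List.mem_map.mp ((SimpleGraph.Walk.support_map _ p) ▸ hy)
    exact z.2
  let c : T.Walk u w := .cons hvu.symm (.cons hvw .nil)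
  have hc : c.IsPath := by
    simp [c, SimpleGraph.Walk.isPath_def, hne, hvu.ne', hvw.ne]
  have heq := (hT.subsingleton_path u w).elim ⟨c, hc⟩ p'.toPath
  have hmem : v ∈ (p'.toPath : T.Walk u w).support := by
    rw [← heq]
    simp [c]
  exact hv (hp' v (SimpleGraph.Walk.support_toPath_subset_support _ hmem))

open scoped Classical in
/-- A vertex `v` of a forest can be chosen so that some union of components of the forest minus `v`
has between `x` and `2 * x - 1` vertices. -/
theorem SimpleGraph.IsAcyclic.exists_split (hT : T.IsAcyclic) (W : Finset V) (x : ℕ)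
    (hx : x < W.card) :
    ∃ v ∈ W, ∃ A ⊆ W.erase v, x ≤ A.card ∧ A.card ≤ 2 * x - 1 ∧
      ∀ a ∈ A, ∀ b ∈ W, T.Adj a b → b ∈ A ∨ b = v := by
  obtain ⟨v₀, hv₀⟩ : W.Nonempty := Finset.card_pos.mp (by omega)
  rcases Nat.eq_zero_or_pos x with rfl | hpos
  · exact ⟨v₀, hv₀, ∅, by simp⟩
  have key : ∀ N : ℕ, ∀ v ∈ W, ∀ A ⊆ W.erase v, A.card = N → x ≤ A.card →
      (∀ a ∈ A, ∀ b ∈ W, T.Adj a b → b ∈ A ∨ b = v) →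
      ∃ v ∈ W, ∃ A ⊆ W.erase v, x ≤ A.card ∧ A.card ≤ 2 * x - 1 ∧
        ∀ a ∈ A, ∀ b ∈ W, T.Adj a b → b ∈ A ∨ b = v := by
    intro N
    induction N using Nat.strong_induction_on with
    | _ N ih =>
    intro v hv A hAW hN hxA hcl
    by_cases hsmall : A.card ≤ 2 * x - 1
    · exact ⟨v, hv, A, hAW, hxA, hsmall, hcl⟩
    have hvA : v ∉ A := fun h => by simpa using hAW h
    obtain ⟨u, huA, hu⟩ : ∃ u ∈ A, (∃ y ∈ A, T.Adj v y) → T.Adj v u := by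
      by_cases h : ∃ y ∈ A, T.Adj v y
      · obtain ⟨y, hy, hvy⟩ := h
        exact ⟨y, hy, fun _ => hvy⟩
      · obtain ⟨y, hy⟩ : A.Nonempty := Finset.card_pos.mp (by omega)
        exact ⟨y, hy, fun h' => absurd h' h⟩
    set K : Finset V := A.filter fun w =>
      ∃ h : w ∈ (A : Set V), (T.induce (A : Set V)).Reachable ⟨u, huA⟩ ⟨w, h⟩ with hK
    have hKA : K ⊆ A := Finset.filter_subset _ _
    have huK : u ∈ K := by
      simp only [hK, Finset.mem_filter]
      exact ⟨huA, huA, SimpleGraph.Reachable.refl _⟩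
    have hKstep : ∀ a ∈ K, ∀ b ∈ A, T.Adj a b → b ∈ K := by
      intro a ha b hb hab
      simp only [hK, Finset.mem_filter] at ha ⊢
      obtain ⟨-, haA, hr⟩ := ha
      refine ⟨hb, hb, hr.trans (SimpleGraph.Adj.reachable ?_)⟩
      simpa using hab
    have hcard := Finset.card_sdiff_add_card_eq_card hKA
    by_cases hKx : K = A
    · have huW : u ∈ W := Finset.mem_of_mem_erase (hAW huA)
      have hc : (A.erase u).card = A.card - 1 := Finset.card_erase_of_mem huA
      refine ih _ ?_ u huW (A.erase u) ?_ rfl ?_ ?_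
      · omega
      · exact Finset.erase_subset_erase _ (hAW.trans (Finset.erase_subset _ _))
      · omega
      · intro a ha b hb hab
        obtain ⟨hau, haA⟩ := Finset.mem_erase.mp ha
        by_cases hbu : b = u
        · exact Or.inr hbu
        rcases hcl a haA b hb hab with h | rfl
        · exact Or.inl (Finset.mem_erase.mpr ⟨hbu, h⟩)
        · exfalso
          have haK : a ∈ K := hKx ▸ haA
          simp only [hK, Finset.mem_filter] at haK
          obtain ⟨-, haA', hr⟩ := haK
          exact hau (hT.eq_of_reachable_induce (A := (A : Set V)) (by simpa using hvA) huA haA'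
            (hu ⟨a, haA, hab.symm⟩) hab.symm hr).symm
    · have hlt : K.card < A.card := Finset.card_lt_card (hKA.ssubset_of_ne hKx)
      have hKpos : 0 < K.card := Finset.card_pos.mpr ⟨u, huK⟩
      by_cases hxK : x ≤ K.card
      · refine ih _ (by omega) v hv K (hKA.trans hAW) rfl hxK ?_
        intro a ha b hb hab
        rcases hcl a (hKA ha) b hb hab with h | h
        · exact Or.inl (hKstep a ha b h hab)
        · exact Or.inr h
      · refine ih _ ?_ v hv (A \ K) (Finset.sdiff_subset.trans hAW) rfl (by omega) ?_
        · omega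
        intro a ha b hb hab
        obtain ⟨haA, haK⟩ := Finset.mem_sdiff.mp ha
        rcases hcl a haA b hb hab with h | h
        · exact Or.inl (Finset.mem_sdiff.mpr ⟨h, fun hbK => haK (hKstep b hbK a haA hab.symm)⟩)
        · exact Or.inr h
  refine key _ v₀ hv₀ (W.erase v₀) subset_rfl rfl ?_ ?_
  · rw [Finset.card_erase_of_mem hv₀]
    omega
  · intro a _ b hb _
    by_cases h : b = v₀
    · exact Or.inr h
    · exact Or.inl (Finset.mem_erase.mpr ⟨h, hb⟩)

end Splitting

/-- An odd multiple `p` of `2 ^ j` reaches the integers strictly between `p - 2 * 2 ^ j` and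
`p + 3 * 2 ^ j`. -/
def DyadicReach (p q : ℤ) : Prop :=
  ∃ (j : ℕ) (t : ℤ), p = (2 * t + 1) * 2 ^ j ∧ p - 2 * 2 ^ j < q ∧ q < p + 3 * 2 ^ j

/-- The graph on the integers joining each integer to those it reaches. -/
def dyadicGraph : SimpleGraph ℤ := SimpleGraph.fromRel DyadicReach

theorem dyadicGraph_adj {p q : ℤ} (k : ℕ) (t : ℤ) (hp : p = (2 * t + 1) * 2 ^ k)
    (hl : p - 2 * 2 ^ k < q) (hr : q < p + 3 * 2 ^ k) (hne : q ≠ p) : dyadicGraph.Adj p q :=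
  (SimpleGraph.fromRel_adj _ _ _).mpr ⟨hne.symm, Or.inl ⟨k, t, hp, hl, hr⟩⟩

/-- Every subforest of `T` on `P.card` vertices embeds into the subgraph of `dyadicGraph` induced
on `P`. -/
def Hosts {V : Type*} (T : SimpleGraph V) (P : Finset ℤ) : Prop :=
  ∀ W : Finset V, W.card = P.card → ∃ f : V → ℤ, Set.InjOn f W ∧ (∀ a ∈ W, f a ∈ P) ∧
    ∀ a ∈ W, ∀ b ∈ W, T.Adj a b → dyadicGraph.Adj (f a) (f b)

section Hosting

variable {V : Type*} {T : SimpleGraph V}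

theorem hosts_empty : Hosts T ∅ := by
  intro W hW
  obtain rfl : W = ∅ := by simpa using hW
  exact ⟨fun _ => 0, by simp⟩

open scoped Classical in
theorem Hosts.of_split (hT : T.IsAcyclic) {P : Finset ℤ} {q : ℤ} (hq : q ∈ P) (x : ℕ)
    (hx : x < P.card) (hadj : ∀ y ∈ P, y ≠ q → dyadicGraph.Adj q y)
    (h : ∀ α : ℕ, x ≤ α → α ≤ 2 * x - 1 →
      ∃ Q ⊆ P.erase q, Q.card = α ∧ Hosts T Q ∧ Hosts T (P.erase q \ Q)) : Hosts T P := by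
  intro W hW
  obtain ⟨v, hv, A, hA, hxA, hAx, hcl⟩ := hT.exists_split W x (by omega)
  obtain ⟨Q, hQ, hQc, hQh, hQh'⟩ := h _ hxA hAx
  obtain ⟨f, hf, hfQ, hfT⟩ := hQh A hQc.symm
  obtain ⟨g, hg, hgQ, hgT⟩ := hQh' (W.erase v \ A) (by
    rw [Finset.card_sdiff_of_subset hA, Finset.card_sdiff_of_subset hQ,
      Finset.card_erase_of_mem hv, Finset.card_erase_of_mem hq, hW, hQc])
  have hvA : v ∉ A := fun h => by simpa using hA h
  have hgQ' : ∀ a ∈ W, a ≠ v → a ∉ A → g a ∈ P ∧ g a ≠ q ∧ g a ∉ Q := by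
    intro a ha hav haA
    have := hgQ a (by simp [ha, hav, haA])
    simp only [Finset.mem_sdiff, Finset.mem_erase] at this
    tauto
  have hfQ' : ∀ a ∈ A, f a ∈ P ∧ f a ≠ q := fun a ha => by
    have := hQ (hfQ a ha)
    simp only [Finset.mem_erase] at this
    tauto
  refine ⟨fun a => if a = v then q else if a ∈ A then f a else g a, ?_, ?_, ?_⟩
  · intro a ha b hb hab
    simp only [Finset.mem_coe] at ha hb
    have hgi : a ∉ A → b ∉ A → a ≠ v → b ≠ v → g a = g b → a = b := fun h1 h2 h3 h4 h5 =>
      hg (by simp [*]) (by simp [*]) h5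
    have hfi : a ∈ A → b ∈ A → f a = f b → a = b := fun h1 h2 h3 => hf h1 h2 h3
    dsimp only at hab
    split_ifs at hab <;> grind
  · intro a ha
    dsimp only
    split_ifs <;> grind
  · intro a ha b hb hab
    have hgi : a ∉ A → b ∉ A → a ≠ v → b ≠ v → dyadicGraph.Adj (g a) (g b) :=
      fun h1 h2 h3 h4 => hgT a (by simp [*]) b (by simp [*]) hab
    have hne := hab.ne
    have h1 : a ∈ A → b ∈ A ∨ b = v := fun h => hcl a h b hb hab
    have h2 : b ∈ A → a ∈ A ∨ a = v := fun h => hcl b h a ha hab.symm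
    have hs := fun y => (hadj y · · |>.symm)
    dsimp only
    split_ifs <;> grind

theorem Hosts.of_erase (hT : T.IsAcyclic) {P : Finset ℤ} {q : ℤ} (hq : q ∈ P)
    (hadj : ∀ y ∈ P, y ≠ q → dyadicGraph.Adj q y) (h : Hosts T (P.erase q)) : Hosts T P :=
  .of_split hT hq 0 (Finset.card_pos.mpr ⟨q, hq⟩) hadj fun α _ hα =>
    ⟨∅, by simp, by simp; omega, hosts_empty, by simpa using h⟩

/-- An interval whose length is controlled by a power of two dividing `p` still hosts every forest
once `p` has been removed from it. -/
theorem hosts_Icc_erase (hT : T.IsAcyclic) (k : ℕ) :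
    ∀ p l r : ℤ, (2 : ℤ) ^ k ∣ p → p - 2 ^ k < l → r < p + 2 ^ k →
      Hosts T ((Finset.Icc l r).erase p) := by
  induction k with
  | zero =>
    intro p l r _ hl hr
    convert hosts_empty (T := T)
    ext y
    simp only [Finset.mem_erase, Finset.mem_Icc, Finset.notMem_empty, iff_false]
    omega
  | succ k ih =>
    rintro _ l r ⟨t, rfl⟩ hl hr
    obtain ⟨p, hp⟩ : ∃ p : ℤ, p = 2 ^ (k + 1) * t := ⟨_, rfl⟩
    obtain ⟨s, hs⟩ : ∃ s : ℤ, s = 2 ^ k := ⟨_, rfl⟩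
    have hs0 : 0 < s := hs ▸ by positivity
    have h2s : (2 : ℤ) ^ (k + 1) = 2 * s := by rw [hs]; ring
    rw [← hp, h2s] at hl hr
    rw [← hp]
    rw [h2s] at hp
    rw [← hs] at ih
    have hps : s ∣ p := ⟨2 * t, by rw [hp]; ring⟩
    have hplus : p + s = (2 * t + 1) * 2 ^ k := by rw [hp, ← hs]; ring
    have hminus : p - s = (2 * (t - 1) + 1) * 2 ^ k := by rw [hp, ← hs]; ring
    have adj : ∀ q u : ℤ, q = (2 * u + 1) * 2 ^ k → ∀ y, q - 2 * s < y → y < q + 3 * s → y ≠ q →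
        dyadicGraph.Adj q y := fun q u hq y h1 h2 h3 =>
      dyadicGraph_adj k u hq (by rw [← hs]; exact h1) (by rw [← hs]; exact h2) h3
    -- an interval from which no vertex has been removed yet
    have full : ∀ q u l r : ℤ, q = (2 * u + 1) * 2 ^ k → q - s < l → r < q + s →
        Hosts T (Finset.Icc l r) := by
      intro q u l r hq hl hr
      have hE := ih q l r ⟨2 * u + 1, by rw [hq, hs]; ring⟩ hl hr
      by_cases hmem : q ∈ Finset.Icc l r
      · refine .of_erase hT hmem (fun y hy hne => ?_) hE
        rw [Finset.mem_Icc] at hy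
        exact adj q u hq y (by omega) (by omega) hne
      · rwa [Finset.erase_eq_of_notMem hmem] at hE
    have right : ∀ l r : ℤ, p - s < l → r < p + 2 * s → Hosts T ((Finset.Icc l r).erase p) := by
      intro l r hl hr
      by_cases hr' : r < p + s
      · exact ih p l r hps hl hr'
      by_cases hlp : p < l
      · rw [Finset.erase_eq_of_notMem (by simp; omega)]
        exact full (p + s) t l r hplus (by omega) (by omega)
      have hcard : (((Finset.Icc l r).erase p).card : ℤ) = r - l := by
        rw [Finset.card_erase_of_mem (by simp; omega), Int.card_Icc]
        omega
      refine .of_split hT (q := p + s) (by simp; omega) (r - (p + s)).toNat (by omega) ?_ ?_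
      · intro y hy hne
        simp only [Finset.mem_erase, Finset.mem_Icc] at hy
        exact adj _ t hplus y (by omega) (by omega) hne
      · intro α h1 h2
        refine ⟨(Finset.Icc (r - α) r).erase (p + s), ?_, ?_, ?_, ?_⟩
        · intro y
          simp only [Finset.mem_erase, Finset.mem_Icc]
          omega
        · rw [Finset.card_erase_of_mem (by simp; omega), Int.card_Icc]
          omega
        · exact ih _ _ _ (hps.add dvd_rfl) (by omega) (by omega)
        · convert ih p l (r - α - 1) hps hl (by omega) using 1
          ext y
          simp only [Finset.mem_sdiff, Finset.mem_erase, Finset.mem_Icc]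
          omega
    by_cases hl' : p - s < l
    · exact right l r hl' hr
    by_cases hrp : r < p
    · rw [Finset.erase_eq_of_notMem (by simp; omega)]
      exact full (p - s) (t - 1) l r hminus (by omega) (by omega)
    have hcard : (((Finset.Icc l r).erase p).card : ℤ) = r - l := by
      rw [Finset.card_erase_of_mem (by simp; omega), Int.card_Icc]
      omega
    refine .of_split hT (q := p - s) (by simp; omega) (p - s - l).toNat (by omega) ?_ ?_
    · intro y hy hne
      simp only [Finset.mem_erase, Finset.mem_Icc] at hy
      exact adj _ (t - 1) hminus y (by omega) (by omega) hne
    · intro α h1 h2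
      refine ⟨(Finset.Icc l (l + α)).erase (p - s), ?_, ?_, ?_, ?_⟩
      · intro y
        simp only [Finset.mem_erase, Finset.mem_Icc]
        omega
      · rw [Finset.card_erase_of_mem (by simp; omega), Int.card_Icc]
        omega
      · exact ih _ _ _ (hps.sub dvd_rfl) (by omega) (by omega)
      · convert right (l + α + 1) r (by omega) hr using 1
        ext y
        simp only [Finset.mem_sdiff, Finset.mem_erase, Finset.mem_Icc]
        omega

theorem hosts_Icc (hT : T.IsAcyclic) {l : ℤ} (r : ℤ) (hl : 0 < l) : Hosts T (Finset.Icc l r) := by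
  have h := hosts_Icc_erase hT r.toNat 0 l r (dvd_zero _)
    (by have : (0 : ℤ) < 2 ^ r.toNat := by positivity
        omega)
    (by have : ((r.toNat : ℕ) : ℤ) < 2 ^ r.toNat := by exact_mod_cast Nat.lt_two_pow_self
        omega)
  rwa [Finset.erase_eq_of_notMem (by simp; omega)] at h

end Hosting

/-- The subgraph of `dyadicGraph` on the integers `1, …, n`. -/
def dyadicInterval (n : ℕ) : SimpleGraph (Fin n) :=
  dyadicGraph.comap fun i : Fin n => ((i : ℕ) : ℤ) + 1

theorem intervalUniversal_dyadicInterval (n : ℕ) : IntervalUniversal (dyadicInterval n) := by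
  refine ⟨Equiv.refl _, fun i m him T hT => ?_⟩
  obtain ⟨f, hf, hfP, hfT⟩ := hosts_Icc hT.isAcyclic (l := i + 1) (i + m) (by omega)
    Finset.univ (by simp)
  have hb : ∀ a, (i : ℤ) + 1 ≤ f a ∧ f a ≤ i + m := fun a => by
    simpa using hfP a (Finset.mem_univ a)
  have hval : ∀ a, (((f a - 1).toNat : ℕ) : ℤ) + 1 = f a := fun a => by
    have := hb a
    omega
  refine ⟨fun a => ⟨(f a - 1).toNat, by have := hb a; omega⟩, ?_, ?_, ?_⟩
  · intro a b hab
    have hab' : (f a - 1).toNat = (f b - 1).toNat := congrArg Fin.val hab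
    refine hf (by simp) (by simp) ?_
    rw [← hval a, ← hval b, hab']
  · intro a
    have := hb a
    exact ⟨_, by dsimp only; omega, by dsimp only; omega, rfl⟩
  · intro a b hab
    simp only [dyadicInterval, SimpleGraph.comap_adj, hval]
    exact hfT a (Finset.mem_univ a) b (Finset.mem_univ b) hab

theorem two_mul_ncard_edgeSet_dyadicInterval_le {n : ℕ} (hn : 1 ≤ n) :
    2 * (dyadicInterval n).edgeSet.ncard ≤ 5 * n * Nat.log 2 n + 15 * n := by
  set L := Nat.log 2 n with hL
  let pos : Fin n → ℤ := fun i => ((i : ℕ) : ℤ) + 1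
  have hpos : Function.Injective pos := fun a b hab => by
    simp only [pos] at hab
    exact Fin.ext (by omega)
  let E : ℕ → Finset (Sym2 ℤ) := fun j =>
    (Finset.range ((n / 2 ^ j + 1) / 2) ×ˢ Finset.range (5 * 2 ^ j)).image fun z : ℕ × ℕ =>
      s((2 * (z.1 : ℤ) + 1) * 2 ^ j, (2 * (z.1 : ℤ) + 1) * 2 ^ j - 2 * 2 ^ j + z.2)
  have hreach : ∀ a b : Fin n, DyadicReach (pos a) (pos b) →
      s(pos a, pos b) ∈ (Finset.range (L + 1)).biUnion E := by
    rintro a b ⟨j, t, hp, hl, hr⟩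
    have hj : (0 : ℤ) < 2 ^ j := by positivity
    have ha1 : 1 ≤ pos a := by simp only [pos]; omega
    have ha2 : pos a ≤ n := by simp only [pos]; have := a.2; omega
    have ht : 0 ≤ t := by
      by_contra ht
      have : (2 * t + 1) * 2 ^ j ≤ 0 := mul_nonpos_of_nonpos_of_nonneg (by omega) hj.le
      omega
    lift t to ℕ using ht
    have hle : (2 * t + 1) * 2 ^ j ≤ n := by
      have : ((2 * t + 1) * 2 ^ j : ℤ) ≤ n := hp ▸ ha2
      exact_mod_cast this
    have hdiv : 2 * t + 1 ≤ n / 2 ^ j := (Nat.le_div_iff_mul_le (by positivity)).mpr hle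
    have hjL : j ≤ L := Nat.le_log_of_pow_le (by norm_num) (by nlinarith [Nat.zero_le (t * 2 ^ j)])
    simp only [E, Finset.mem_biUnion, Finset.mem_range, Finset.mem_image, Finset.mem_product]
    refine ⟨j, by omega, (t, (pos b - (pos a - 2 * 2 ^ j)).toNat), ⟨by dsimp only; omega, ?_⟩, ?_⟩
    · have h5 : ((5 * 2 ^ j : ℕ) : ℤ) = 5 * 2 ^ j := by push_cast; ring
      dsimp only
      omega
    · dsimp only
      rw [← hp, Int.toNat_of_nonneg (by omega)]
      rw [add_sub_cancel]
  have hsub : Sym2.map pos '' (dyadicInterval n).edgeSet ⊆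
      ((Finset.range (L + 1)).biUnion E : Finset (Sym2 ℤ)) := by
    rintro _ ⟨e, he, rfl⟩
    induction e using Sym2.ind with
    | _ a b =>
    rw [SimpleGraph.mem_edgeSet] at he
    obtain ⟨-, h | h⟩ := (SimpleGraph.fromRel_adj _ _ _).mp he
    · simpa using hreach a b h
    · rw [Sym2.eq_swap]
      simpa using hreach b a h
  have hle : (dyadicInterval n).edgeSet.ncard ≤ ((Finset.range (L + 1)).biUnion E).card := by
    rw [← Set.ncard_image_of_injective _ (Sym2.map.injective hpos), ← Set.ncard_coe_finset]
    exact Set.ncard_le_ncard hsub (Finset.finite_toSet _)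
  have hE : ∀ j, 2 * (E j).card ≤ 5 * n + 5 * 2 ^ j := fun j => by
    have h1 : (E j).card ≤ (n / 2 ^ j + 1) / 2 * (5 * 2 ^ j) := by
      refine Finset.card_image_le.trans ?_
      simp
    have h2 : 2 * ((n / 2 ^ j + 1) / 2) ≤ n / 2 ^ j + 1 := Nat.mul_div_le _ _
    have h3 : n / 2 ^ j * 2 ^ j ≤ n := Nat.div_mul_le_self _ _
    calc 2 * (E j).card ≤ 2 * ((n / 2 ^ j + 1) / 2) * (5 * 2 ^ j) := by rw [mul_assoc]; omega
      _ ≤ (n / 2 ^ j + 1) * (5 * 2 ^ j) := Nat.mul_le_mul_right _ h2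
      _ = 5 * (n / 2 ^ j * 2 ^ j) + 5 * 2 ^ j := by ring
      _ ≤ 5 * n + 5 * 2 ^ j := by omega
  have hpow : 2 ^ L ≤ n := Nat.pow_log_le_self 2 (by omega)
  have hgeom : ∑ j ∈ Finset.range (L + 1), 2 ^ j ≤ 2 * n := by
    have := Nat.geomSum_eq (m := 2) le_rfl (L + 1)
    rw [this, pow_succ]
    omega
  calc 2 * (dyadicInterval n).edgeSet.ncard
      ≤ 2 * ∑ j ∈ Finset.range (L + 1), (E j).card :=
        Nat.mul_le_mul_left _ (hle.trans Finset.card_biUnion_le)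
    _ ≤ ∑ j ∈ Finset.range (L + 1), (5 * n + 5 * 2 ^ j) := by
        rw [Finset.mul_sum]
        exact Finset.sum_le_sum fun j _ => hE j
    _ = 5 * n * L + 5 * n + 5 * ∑ j ∈ Finset.range (L + 1), 2 ^ j := by
        rw [Finset.sum_add_distrib, Finset.mul_sum _ _ 5, Finset.sum_const, Finset.card_range,
          smul_eq_mul]
        ring
    _ ≤ 5 * n * L + 15 * n := by omega

/-- There is a constant `C` such that for every `n ≥ 1` there is an `n`-vertex graph that is
interval-universal for trees with at most `(14/5)·n·log₂ n + C·n` edges. -/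
theorem statement8 :
    ∃ C : ℝ, ∀ n : ℕ, 1 ≤ n →
      ∃ G : SimpleGraph (Fin n),
        IntervalUniversal G ∧
        (G.edgeSet.ncard : ℝ) ≤ (14 / 5) * n * Real.logb 2 n + C * n := by
  refine ⟨15 / 2, fun n hn => ⟨dyadicInterval n, intervalUniversal_dyadicInterval n, ?_⟩⟩
  have h : 2 * ((dyadicInterval n).edgeSet.ncard : ℝ) ≤ 5 * n * (Nat.log 2 n : ℕ) + 15 * n := by
    exact_mod_cast two_mul_ncard_edgeSet_dyadicInterval_le hn
  have hlog : ((Nat.log 2 n : ℕ) : ℝ) ≤ Real.logb 2 n := by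
    exact_mod_cast Real.natLog_le_logb n 2
  have hn0 : (0 : ℝ) ≤ n := Nat.cast_nonneg n
  have hmul := mul_le_mul_of_nonneg_left hlog hn0
  have hnonneg : 0 ≤ (n : ℝ) * (Nat.log 2 n : ℕ) := by positivity
  linarith
end
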